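/- arXiv:1508.00614 — 2 statements merged into one kernel-verified Lean document; each statement's English description precedes it below -/
import Mathlib

section
/- A matching M in a bipartite graph G with strict preferences is popular if and only if the subgraph G_M (obtained from G by deleting all edges labeled (−,−)) contains (i) no alternating cycle with respect to M containing a (+,+) edge, (ii) no alternating path starting at a vertex unmatched in M containing a (+,+) edge, and (iii) no alternating path with respect to M containing two or more (+,+) edges. -/
open Classical

/-- A bipartite graph `G = (A ∪ B, E)` with strict preference lists:
`adj` is the edge relation, and each vertex ranks its neighbors by a rank
function (lower rank = more preferred), injective on neighbors. -/
structure PrefSys (A B : Type) where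
  adj : A → B → Prop
  rankA : A → B → ℕ
  rankB : B → A → ℕ
  rankA_inj : ∀ a b b', adj a b → adj a b' → rankA a b = rankA a b' → b = b'
  rankB_inj : ∀ b a a', adj a b → adj a' b → rankB b a = rankB b a' → a = a'

namespace PrefSys

variable {A B : Type} (P : PrefSys A B)

/-- `M` is a matching of `G`: a set of edges, no two sharing a vertex. -/
def IsMatching (M : Finset (A × B)) : Prop :=
  (∀ p ∈ M, P.adj p.1 p.2) ∧
  (∀ p ∈ M, ∀ q ∈ M, p.1 = q.1 → p = q) ∧
  (∀ p ∈ M, ∀ q ∈ M, p.2 = q.2 → p = q)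

/-- Vertex `a ∈ A` prefers matching `M` to matching `M'`:
`a` is matched in `M` and either unmatched in `M'` or matched to a strictly
worse partner in `M'`. -/
def prefA (M M' : Finset (A × B)) (a : A) : Prop :=
  ∃ b, (a, b) ∈ M ∧ ∀ b', (a, b') ∈ M' → P.rankA a b < P.rankA a b'

/-- Vertex `b ∈ B` prefers matching `M` to matching `M'`. -/
def prefB (M M' : Finset (A × B)) (b : B) : Prop :=
  ∃ a, (a, b) ∈ M ∧ ∀ a', (a', b) ∈ M' → P.rankB b a < P.rankB b a'

/-- `φ(M, M')`: the number of vertices preferring `M` to `M'`. -/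
noncomputable def phi (M M' : Finset (A × B)) : ℕ :=
  Nat.card {a : A // P.prefA M M' a} + Nat.card {b : B // P.prefB M M' b}

/-- A matching is popular if it never loses a head-to-head election. -/
def Popular (M : Finset (A × B)) : Prop :=
  P.IsMatching M ∧ ∀ M', P.IsMatching M' → P.phi M' M ≤ P.phi M M'

/-- `a`'s vote on the edge `(a,b)` versus its `M`-partner is `+`. -/
def voteAplus (M : Finset (A × B)) (a : A) (b : B) : Prop :=
  ∀ b', (a, b') ∈ M → P.rankA a b < P.rankA a b'

/-- `b`'s vote on the edge `(a,b)` versus its `M`-partner is `+`. -/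
def voteBplus (M : Finset (A × B)) (a : A) (b : B) : Prop :=
  ∀ a', (a', b) ∈ M → P.rankB b a < P.rankB b a'

/-- `(a,b)` is a blocking edge (an edge outside `M` labeled `(+,+)`). -/
def Blocking (M : Finset (A × B)) (a : A) (b : B) : Prop :=
  P.adj a b ∧ (a, b) ∉ M ∧ P.voteAplus M a b ∧ P.voteBplus M a b

/-- A stable matching: a matching with no blocking edge. -/
def Stable (M : Finset (A × B)) : Prop :=
  P.IsMatching M ∧ ∀ a b, ¬ P.Blocking M a b

/-- A dominant matching: popular, and more popular than every larger matching. -/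
def Dominant (M : Finset (A × B)) : Prop :=
  P.Popular M ∧ ∀ M', P.IsMatching M' → M.card < M'.card → P.phi M' M < P.phi M M'

/-- The edge `(a,b)` survives in the subgraph `G_M` (i.e. it is an edge of `G`
that is in `M` or is not labeled `(-,-)`). -/
def inGM (M : Finset (A × B)) (a : A) (b : B) : Prop :=
  P.adj a b ∧ ((a, b) ∈ M ∨ P.voteAplus M a b ∨ P.voteBplus M a b)

end PrefSys

namespace PrefSys

variable {A B : Type} (P : PrefSys A B)

/-- Vertices of `G`, as a sum type. -/
abbrev V (A B : Type) := Sum A B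

/-- Adjacency in the subgraph `G_M` (symmetrized). -/
def vAdjGM (M : Finset (A × B)) : V A B → V A B → Prop
  | .inl a, .inr b => P.inGM M a b
  | .inr b, .inl a => P.inGM M a b
  | _, _ => False

/-- The (unordered) pair `{x,y}` is an edge of the matching `M`. -/
def vInM (M : Finset (A × B)) : V A B → V A B → Prop
  | .inl a, .inr b => (a, b) ∈ M
  | .inr b, .inl a => (a, b) ∈ M
  | _, _ => False

/-- The (unordered) pair `{x,y}` is an edge labeled `(+,+)` wrt `M`. -/
def vPlusPlus (M : Finset (A × B)) : V A B → V A B → Prop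
  | .inl a, .inr b => P.Blocking M a b
  | .inr b, .inl a => P.Blocking M a b
  | _, _ => False

/-- The vertex `x` is matched in `M`. -/
def vMatched (M : Finset (A × B)) : V A B → Prop
  | .inl a => ∃ b, (a, b) ∈ M
  | .inr b => ∃ a, (a, b) ∈ M

/-- The list of consecutive pairs of a vertex list. -/
def edgesOf (v : List (V A B)) : List (V A B × V A B) := v.zip v.tail

/-- An alternating path with respect to `M` in the subgraph `G_M`:
a list of distinct vertices, consecutive ones adjacent in `G_M`, whose edges
alternate between matching and non-matching edges. -/
def IsAltPath (M : Finset (A × B)) (v : List (V A B)) : Prop :=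
  v.Nodup ∧ v.Chain' (P.vAdjGM M) ∧
  (edgesOf v).Chain' (fun e f => vInM M e.1 e.2 ↔ ¬ vInM M f.1 f.2)

/-- An augmenting path with respect to `M` in `G_M`: an alternating path with
at least one edge, both of whose endpoints are unmatched in `M`. -/
def IsAugPath (M : Finset (A × B)) (v : List (V A B)) : Prop :=
  P.IsAltPath M v ∧ 2 ≤ v.length ∧
  (∀ x, v.head? = some x → ¬ vMatched M x) ∧
  (∀ x, v.getLast? = some x → ¬ vMatched M x)

/-- The edges of a cycle given by a vertex list (consecutive pairs plus the
closing edge from the last vertex to the first). -/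
def cycEdgesOf (v : List (V A B)) : List (V A B × V A B) :=
  match v.head?, v.getLast? with
  | some x, some y => edgesOf v ++ [(y, x)]
  | _, _ => []

/-- An alternating cycle with respect to `M` in the subgraph `G_M`. -/
def IsAltCycle (M : Finset (A × B)) (v : List (V A B)) : Prop :=
  v.Nodup ∧ 4 ≤ v.length ∧
  (∀ e ∈ cycEdgesOf v, P.vAdjGM M e.1 e.2) ∧
  (cycEdgesOf v).Chain' (fun e f => vInM M e.1 e.2 ↔ ¬ vInM M f.1 f.2)

/-- The set of `G`-edges (as pairs in `A × B`) used by a list of vertex pairs. -/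
noncomputable def edgeFinset (l : List (V A B × V A B)) : Finset (A × B) :=
  (l.filterMap (fun e => match e with
    | (.inl a, .inr b) => some (a, b)
    | (.inr b, .inl a) => some (a, b)
    | _ => none)).toFinset

/-- `M ⊕ ρ`: switch `M` along the path with vertex list `v`. -/
noncomputable def augment (M : Finset (A × B)) (v : List (V A B)) : Finset (A × B) :=
  symmDiff M (edgeFinset (edgesOf v))

end PrefSys

namespace PrefSys

section Vertices

variable {A B : Type} (P : PrefSys A B) {M M' : Finset (A × B)}

/-- Adjacency in `G`, symmetrized on the vertex type. -/
def vAdj : V A B → V A B → Prop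
  | .inl a, .inr b => P.adj a b
  | .inr b, .inl a => P.adj a b
  | _, _ => False

/-- The rank a vertex gives to another vertex. -/
def vRank : V A B → V A B → ℕ
  | .inl a, .inr b => P.rankA a b
  | .inr b, .inl a => P.rankB b a
  | _, _ => 0

/-- The vote of `x` on the edge `{x,y}` versus its `M`-partner is `+`. -/
def vVote (M : Finset (A × B)) (x y : V A B) : Prop :=
  ∀ w, vInM M x w → P.vRank x y < P.vRank x w

/-- The vertex `x` prefers `M` to `M'`. -/
def vPref (M M' : Finset (A × B)) (x : V A B) : Prop :=
  ∃ u, vInM M x u ∧ P.vVote M' x u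

theorem vInM_symm {x y : V A B} (h : vInM M x y) : vInM M y x := by
  rcases x with a | b <;> rcases y with a' | b' <;> simp_all [vInM]

variable {P}

theorem IsMatching.unique (hM : P.IsMatching M) {x y z : V A B}
    (h : vInM M x y) (h' : vInM M x z) : y = z := by
  obtain ⟨-, h1, h2⟩ := hM
  rcases x with a | b <;> rcases y with a' | b' <;> rcases z with a'' | b'' <;>
    simp only [vInM] at h h'
  · exact congrArg Sum.inr (congrArg Prod.snd (h1 _ h _ h' rfl))
  · exact congrArg Sum.inl (congrArg Prod.fst (h2 _ h _ h' rfl))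

theorem IsMatching.vAdj (hM : P.IsMatching M) {x y : V A B} (h : vInM M x y) :
    P.vAdj x y := by
  rcases x with a | b <;> rcases y with a' | b' <;> simp only [vInM] at h
  · exact hM.1 _ h
  · exact hM.1 _ h

theorem vAdj_symm {x y : V A B} (h : P.vAdj x y) : P.vAdj y x := by
  rcases x with a | b <;> rcases y with a' | b' <;> simp_all [vAdj]

theorem vAdj_isLeft {x y : V A B} (h : P.vAdj x y) : x.isLeft ≠ y.isLeft := by
  rcases x with a | b <;> rcases y with a' | b' <;> simp_all [vAdj]

theorem vAdj_ne {x y : V A B} (h : P.vAdj x y) : x ≠ y := by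
  rintro rfl
  exact vAdj_isLeft h rfl

theorem vRank_inj {x y z : V A B} (h : P.vAdj x y) (h' : P.vAdj x z)
    (hr : P.vRank x y = P.vRank x z) : y = z := by
  rcases x with a | b <;> rcases y with a' | b' <;> rcases z with a'' | b'' <;>
    simp only [vAdj, vRank] at h h' hr
  · rw [P.rankA_inj _ _ _ h h' hr]
  · rw [P.rankB_inj _ _ _ h h' hr]

theorem vAdjGM_iff {x y : V A B} : P.vAdjGM M x y ↔
    P.vAdj x y ∧ (vInM M x y ∨ P.vVote M x y ∨ P.vVote M y x) := by
  rcases x with a | b <;> rcases y with a' | b' <;>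
    simp [vAdjGM, vAdj, vInM, vVote, vRank, inGM, voteAplus, voteBplus]
  intro _
  tauto

theorem vPlusPlus_iff {x y : V A B} : P.vPlusPlus M x y ↔
    P.vAdj x y ∧ ¬ vInM M x y ∧ P.vVote M x y ∧ P.vVote M y x := by
  rcases x with a | b <;> rcases y with a' | b' <;>
    simp [vPlusPlus, vAdj, vInM, vVote, vRank, Blocking, voteAplus, voteBplus]
  tauto

theorem vPlusPlus_symm {x y : V A B} (h : P.vPlusPlus M x y) : P.vPlusPlus M y x := by
  rw [vPlusPlus_iff] at h ⊢
  exact ⟨vAdj_symm h.1, fun h' => h.2.1 (vInM_symm h'), h.2.2.2, h.2.2.1⟩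

theorem vPlusPlus.not_vInM {x y : V A B} (h : P.vPlusPlus M x y) : ¬ vInM M x y :=
  (vPlusPlus_iff.1 h).2.1

theorem vPlusPlus.vAdjGM {x y : V A B} (h : P.vPlusPlus M x y) : P.vAdjGM M x y := by
  rw [vPlusPlus_iff] at h
  exact vAdjGM_iff.2 ⟨h.1, .inr (.inl h.2.2.1)⟩

theorem vAdjGM_symm {x y : V A B} (h : P.vAdjGM M x y) : P.vAdjGM M y x := by
  rw [vAdjGM_iff] at h ⊢
  exact ⟨vAdj_symm h.1, h.2.imp vInM_symm Or.symm⟩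

theorem IsMatching.vAdjGM (hM : P.IsMatching M) {x y : V A B} (h : vInM M x y) :
    P.vAdjGM M x y :=
  vAdjGM_iff.2 ⟨hM.vAdj h, .inl h⟩

theorem vMatched_iff {x : V A B} : vMatched M x ↔ ∃ y, vInM M x y := by
  rcases x with a | b <;> simp [vMatched, vInM]

theorem phi_eq_ncard_vPref [Fintype A] [Fintype B] :
    P.phi M M' = {x | P.vPref M M' x}.ncard := by
  have h : ∀ x, P.vPref M M' x ↔ Sum.elim (P.prefA M M') (P.prefB M M') x := by
    rintro (a | b) <;> simp [vPref, vVote, vInM, vRank, prefA, prefB]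
  rw [phi, ← Nat.card_sum, ← Nat.card_coe_set_eq]
  refine Nat.card_congr (Equiv.trans ?_ (Equiv.subtypeEquivRight fun x => (h x).symm))
  exact (Equiv.subtypeSum (p := Sum.elim (P.prefA M M') (P.prefB M M'))).symm

/-- A vertex matched by an edge of `M'` outside `M` strictly prefers one of them. -/
theorem vPref_or_vPref (hM : P.IsMatching M) (hM' : P.IsMatching M') {x y : V A B}
    (h : vInM M' x y) (hn : ¬ vInM M x y) : P.vPref M' M x ∨ P.vPref M M' x := by
  by_cases hm : ∃ w, vInM M x w
  · obtain ⟨w, hw⟩ := hm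
    rcases lt_trichotomy (P.vRank x y) (P.vRank x w) with hr | hr | hr
    · exact .inl ⟨y, h, fun w' hw' => hM.unique hw hw' ▸ hr⟩
    · exact absurd (vRank_inj (hM'.vAdj h) (hM.vAdj hw) hr ▸ hw) hn
    · exact .inr ⟨w, hw, fun w' hw' => hM'.unique h hw' ▸ hr⟩
  · exact .inl ⟨y, h, fun w hw => absurd ⟨w, hw⟩ hm⟩

theorem vPref_asymm {x : V A B} (h : P.vPref M M' x) : ¬ P.vPref M' M x := by
  rintro ⟨u, hu, hu'⟩
  obtain ⟨w, hw, hw'⟩ := h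
  exact lt_asymm (hu' _ hw) (hw' _ hu)

theorem vVote_of_vPref (hM : P.IsMatching M) {x y : V A B}
    (h : vInM M x y) (hp : P.vPref M M' x) : P.vVote M' x y := by
  obtain ⟨u, hu, hv⟩ := hp
  exact hM.unique hu h ▸ hv

end Vertices

section Swap

theorem ncard_le_ncard_of_rel {α β : Type*} [Finite β] {s : Set α} {t : Set β}
    (r : α → β → Prop) (h : ∀ a ∈ s, ∃ b ∈ t, r a b)
    (hr : ∀ a a' b, r a b → r a' b → a = a') : s.ncard ≤ t.ncard := by
  choose f hf hrf using h
  rw [← Nat.card_coe_set_eq, ← Nat.card_coe_set_eq]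
  refine Nat.card_le_card_of_injective (fun a : s => (⟨f a a.2, hf a a.2⟩ : t)) fun a a' h => ?_
  have h : f a a.2 = f a' a'.2 := congrArg Subtype.val h
  exact Subtype.ext (hr a a' _ (hrf a a.2) (h ▸ hrf a' a'.2))

variable {A B : Type} {P : PrefSys A B} {M : Finset (A × B)}

/-- Comparing a popular matching `M` with the matching obtained by swapping in a set `n` of
non-matching edges of `G_M`: the endpoints of `(+,+)` edges in `n` are outnumbered by the
vertices left without a partner. -/
theorem Popular.ncard_plusPlus_le [Fintype A] [Fintype B] (hP : P.Popular M)
    (n : V A B → V A B → Prop) (hs : ∀ x y, n x y → n y x)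
    (hu : ∀ x y z, n x y → n x z → y = z)
    (hG : ∀ x y, n x y → P.vAdjGM M x y ∧ ¬ vInM M x y) :
    {x | ∃ u, n x u ∧ P.vPlusPlus M x u}.ncard ≤
      {y | (¬ ∃ u, n y u) ∧ ∃ x, vInM M y x ∧ ∃ u, n x u}.ncard := by
  obtain ⟨hM, hpop⟩ := hP
  set M' : Finset (A × B) := Finset.univ.filter fun p =>
    n (.inl p.1) (.inr p.2) ∨
      ((p ∈ M ∧ ¬ ∃ u, n (.inl p.1) u) ∧ ¬ ∃ u, n (.inr p.2) u) with hM'def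
  have memM' : ∀ a b, (a, b) ∈ M' ↔ n (.inl a) (.inr b) ∨
      (((a, b) ∈ M ∧ ¬ ∃ u, n (.inl a) u) ∧ ¬ ∃ u, n (.inr b) u) := fun a b => by
    rw [hM'def, Finset.mem_filter]
    exact and_iff_right (Finset.mem_univ _)
  clear_value M'
  have hE : ∀ x y, n x y → P.vAdj x y := fun x y h => (vAdjGM_iff.1 (hG x y h).1).1
  have key : ∀ x y, vInM M' x y ↔
      n x y ∨ ((vInM M x y ∧ ¬ ∃ u, n x u) ∧ ¬ ∃ u, n y u) := by
    rintro (a | b) (a' | b')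
    · have := hE (.inl a) (.inl a')
      simpa [vInM, vAdj] using this
    · rw [vInM, memM', vInM]
    · have h : n (.inl a') (.inr b) ↔ n (.inr b) (.inl a') := ⟨hs _ _, hs _ _⟩
      rw [vInM, memM', h, and_right_comm, vInM]
    · have := hE (.inr b) (.inr b')
      simpa [vInM, vAdj] using this
  have huniq : ∀ x y z, vInM M' x y → vInM M' x z → y = z := by
    intro x y z h h'
    rw [key] at h h'
    rcases h with h | h <;> rcases h' with h' | h'
    · exact hu _ _ _ h h'
    · exact absurd ⟨_, h⟩ h'.1.2
    · exact absurd ⟨_, h'⟩ h.1.2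
    · exact hM.unique h.1.1 h'.1.1
  have hM' : P.IsMatching M' := by
    refine ⟨?_, ?_, ?_⟩
    · rintro ⟨a, b⟩ h
      rcases (key (.inl a) (.inr b)).1 h with h | h
      · exact hE _ _ h
      · exact hM.1 _ h.1.1
    · rintro ⟨a, b⟩ h ⟨a', b'⟩ h' rfl
      exact congrArg (Prod.mk a) (Sum.inr.inj (huniq (.inl a) (.inr b) (.inr b') h h'))
    · rintro ⟨a, b⟩ h ⟨a', b'⟩ h' rfl
      exact congrArg (Prod.mk · b) (Sum.inl.inj (huniq (.inr b) (.inl a) (.inl a') h h'))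
  have hle := hpop M' hM'
  rw [phi_eq_ncard_vPref, phi_eq_ncard_vPref] at hle
  have hSP : {x | ∃ u, n x u ∧ P.vPlusPlus M x u} ⊆ {x | P.vPref M' M x} := by
    rintro x ⟨u, hu1, hu2⟩
    exact ⟨u, (key _ _).2 (.inl hu1), (vPlusPlus_iff.1 hu2).2.2.1⟩
  have hsub : {y | P.vPref M M' y} ⊆
      {y | (¬ ∃ u, n y u) ∧ ∃ x, vInM M y x ∧ ∃ u, n x u} ∪
        {y | P.vPref M M' y ∧ ∃ u, n y u} := by
    intro y hy
    by_cases hc : ∃ u, n y u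
    · exact .inr ⟨hy, hc⟩
    · obtain ⟨x, hx, hv⟩ := hy
      refine .inl ⟨hc, x, hx, ?_⟩
      by_contra hx'
      exact lt_irrefl _ (hv x ((key _ _).2 (.inr ⟨⟨hx, hc⟩, hx'⟩)))
  have hinj : {y | P.vPref M M' y ∧ ∃ u, n y u}.ncard ≤
      ({x | P.vPref M' M x} \ {x | ∃ u, n x u ∧ P.vPlusPlus M x u}).ncard := by
    refine ncard_le_ncard_of_rel n ?_ fun y y' u hy hy' => hu _ _ _ (hs _ _ hy) (hs _ _ hy')
    rintro y ⟨hy, u, hyu⟩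
    have hnv : ¬ P.vVote M y u := fun hv =>
      vPref_asymm hy ⟨u, (key _ _).2 (.inl hyu), hv⟩
    obtain ⟨h1, h2⟩ := hG _ _ hyu
    refine ⟨u, ⟨⟨y, (key _ _).2 (.inl (hs _ _ hyu)), ?_⟩, ?_⟩, hyu⟩
    · have := (vAdjGM_iff.1 h1).2
      tauto
    · rintro ⟨y', h3, h4⟩
      obtain rfl := hu _ _ _ h3 (hs _ _ hyu)
      exact hnv (vPlusPlus_iff.1 h4).2.2.2
  have h1 := Set.ncard_le_ncard hsub
  have h2 := Set.ncard_union_le {y | (¬ ∃ u, n y u) ∧ ∃ x, vInM M y x ∧ ∃ u, n x u}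
    {y | P.vPref M M' y ∧ ∃ u, n y u}
  have h3 := Set.ncard_sdiff_add_ncard_of_subset hSP
  omega

end Swap

section ZigZag

variable {A B : Type} (P : PrefSys A B) (M : Finset (A × B))

/-- An alternating list of vertices in `G_M` with first vertex `x` and last vertex `t` whose
first and last edges are not in `M`. -/
inductive ZigZag : V A B → V A B → List (V A B) → Prop
  | pair {x t : V A B} : P.vAdjGM M x t → ¬ vInM M x t → ZigZag x t [x, t]
  | cons {x t y z : V A B} {l : List (V A B)} : ZigZag x t l → P.vAdjGM M z y →
      ¬ vInM M z y → vInM M y x → ZigZag z t (z :: y :: l)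

/-- The disjoint consecutive pairs of a list. -/
def pairs {α : Type*} : List α → List (α × α)
  | x :: y :: l => (x, y) :: pairs l
  | _ => []

theorem mem_of_mem_pairs {α : Type*} {p q : α} : ∀ {l : List α}, (p, q) ∈ pairs l → p ∈ l ∧ q ∈ l
  | [], h => by simp [pairs] at h
  | [_], h => by simp [pairs] at h
  | x :: y :: l, h => by
    simp only [pairs, List.mem_cons, Prod.mk.injEq] at h
    rcases h with ⟨rfl, rfl⟩ | h
    · simp
    · have := mem_of_mem_pairs h
      simp [this]

theorem pairs_unique {α : Type*} {p q q' : α} : ∀ {l : List α}, l.Nodup →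
    ((p, q) ∈ pairs l ∨ (q, p) ∈ pairs l) → ((p, q') ∈ pairs l ∨ (q', p) ∈ pairs l) → q = q'
  | [], _, h, _ => by simp [pairs] at h
  | [_], _, h, _ => by simp [pairs] at h
  | x :: y :: l, hn, h, h' => by
    simp only [pairs, List.mem_cons, Prod.mk.injEq] at h h'
    simp only [List.nodup_cons, List.mem_cons, not_or] at hn
    have ih := pairs_unique (p := p) (q := q) (q' := q') hn.2.2
    have m1 := mem_of_mem_pairs (p := p) (q := q) (l := l)
    have m2 := mem_of_mem_pairs (p := q) (q := p) (l := l)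
    have m3 := mem_of_mem_pairs (p := p) (q := q') (l := l)
    have m4 := mem_of_mem_pairs (p := q') (q := p) (l := l)
    grind

variable {P M} {x t : V A B} {l : List (V A B)}

theorem ZigZag.mem_pairs (h : ZigZag P M x t l) {p q : V A B} (hp : (p, q) ∈ pairs l) :
    P.vAdjGM M p q ∧ ¬ vInM M p q := by
  induction h with
  | pair h1 h2 => simp [pairs] at hp; simp_all
  | cons _ h1 h2 _ ih =>
    simp only [pairs, List.mem_cons, Prod.mk.injEq] at hp
    rcases hp with ⟨rfl, rfl⟩ | hp
    · exact ⟨h1, h2⟩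
    · exact ih hp

theorem ZigZag.exists_pair (h : ZigZag P M x t l) {p : V A B} (hp : p ∈ l) :
    ∃ q, (p, q) ∈ pairs l ∨ (q, p) ∈ pairs l := by
  induction h with
  | @pair x t h1 h2 =>
    simp only [List.mem_cons, List.not_mem_nil, or_false] at hp
    rcases hp with rfl | rfl
    · exact ⟨t, by simp [pairs]⟩
    · exact ⟨x, by simp [pairs]⟩
  | @cons x t y z l _ h1 h2 _ ih =>
    simp only [List.mem_cons] at hp
    rcases hp with rfl | rfl | hp
    · exact ⟨y, by simp [pairs]⟩
    · exact ⟨z, by simp [pairs]⟩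
    · obtain ⟨q, hq⟩ := ih hp
      exact ⟨q, by simp only [pairs, List.mem_cons]; tauto⟩

theorem ZigZag.first_mem (h : ZigZag P M x t l) : x ∈ l := by
  cases h <;> simp

theorem ZigZag.last_mem (h : ZigZag P M x t l) : t ∈ l := by
  induction h with
  | pair => simp
  | cons _ _ _ _ ih => simp [ih]

theorem ZigZag.getLast? (h : ZigZag P M x t l) : l.getLast? = some t := by
  induction h with
  | pair => simp
  | cons _ _ _ _ ih => simp [List.getLast?_cons, ih]

theorem ZigZag.partner (hM : P.IsMatching M) (h : ZigZag P M x t l) {w v : V A B}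
    (hw : w ∈ l) (hv : vInM M w v) : w = x ∨ w = t ∨ v ∈ l := by
  induction h with
  | pair =>
    simp only [List.mem_cons, List.not_mem_nil, or_false] at hw
    tauto
  | @cons x t y z l h h1 h2 h3 ih =>
    simp only [List.mem_cons] at hw
    rcases hw with rfl | rfl | hw
    · exact .inl rfl
    · obtain rfl := hM.unique h3 hv
      simp [h.first_mem]
    · rcases ih hw with rfl | h | h
      · obtain rfl := hM.unique (vInM_symm h3) hv
        simp
      · exact .inr (.inl h)
      · simp [h]

theorem ZigZag.isLeft (hM : P.IsMatching M) (h : ZigZag P M x t l) :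
    x.isLeft ≠ t.isLeft := by
  induction h with
  | pair h1 => exact vAdj_isLeft (vAdjGM_iff.1 h1).1
  | cons _ h1 _ h3 ih =>
    have h4 := vAdj_isLeft (vAdjGM_iff.1 h1).1
    have h5 := vAdj_isLeft (hM.vAdj h3)
    grind

theorem edgesOf_cons_cons (x y : V A B) (l : List (V A B)) :
    edgesOf (x :: y :: l) = (x, y) :: edgesOf (y :: l) := rfl

theorem rel_of_mem_edgesOf {R : V A B → V A B → Prop} {e : V A B × V A B} :
    ∀ {l : List (V A B)}, l.IsChain R → e ∈ edgesOf l → R e.1 e.2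
  | [], _, h => by simp [edgesOf] at h
  | [_], _, h => by simp [edgesOf] at h
  | x :: y :: l, hc, h => by
    rw [edgesOf_cons_cons, List.mem_cons] at h
    rw [List.isChain_cons_cons] at hc
    rcases h with rfl | h
    · exact hc.1
    · exact rel_of_mem_edgesOf hc.2 h

theorem edgesOf_concat (x : V A B) : ∀ (l : List (V A B)) (y : V A B), l.getLast? = some y →
    edgesOf (l ++ [x]) = edgesOf l ++ [(y, x)]
  | [], _, h => by simp at h
  | [z], y, h => by
    simp at h
    simp [edgesOf, h]
  | z :: w :: l, y, h => by
    have ih := edgesOf_concat x (w :: l) y (by simpa [List.getLast?_cons] using h)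
    simp only [List.cons_append] at ih
    simp only [List.cons_append, edgesOf_cons_cons, ih]

theorem cycEdgesOf_cons (x : V A B) (l : List (V A B)) :
    cycEdgesOf (x :: l) = edgesOf (x :: l ++ [x]) := by
  obtain ⟨y, hy⟩ : ∃ y, (x :: l).getLast? = some y := by simp [List.getLast?_cons]
  rw [edgesOf_concat x _ y hy, cycEdgesOf, hy]
  simp

theorem exists_append_of_edgesOf_eq {p q : V A B} : ∀ {v : List (V A B)}
    {l₁ l₂ : List (V A B × V A B)}, edgesOf v = l₁ ++ (p, q) :: l₂ →
    ∃ v₁ v₂, v = v₁ ++ p :: q :: v₂ ∧ edgesOf (q :: v₂) = l₂ ∧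
      edgesOf (p :: q :: v₂) <:+ edgesOf v
  | [], _, _, h => by simp [edgesOf] at h
  | [_], _, _, h => by simp [edgesOf] at h
  | x :: y :: l, [], l₂, h => by
    rw [edgesOf_cons_cons, List.nil_append, List.cons.injEq, Prod.mk.injEq] at h
    obtain ⟨⟨rfl, rfl⟩, h⟩ := h
    exact ⟨[], l, rfl, h, List.suffix_refl _⟩
  | x :: y :: l, e :: l₁, l₂, h => by
    rw [edgesOf_cons_cons, List.cons_append, List.cons.injEq] at h
    obtain ⟨v₁, v₂, h1, h2, h3⟩ := exists_append_of_edgesOf_eq h.2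
    refine ⟨x :: v₁, v₂, by simp [h1], h2, h3.trans ?_⟩
    rw [edgesOf_cons_cons x]
    exact List.suffix_cons _ _

theorem ZigZag.mem_edgesOf (h : ZigZag P M x t l) {p q : V A B} (hp : (p, q) ∈ edgesOf l) :
    (p, q) ∈ pairs l ∨ vInM M p q := by
  induction h with
  | pair => left; simpa [edgesOf, pairs] using hp
  | @cons x t y z l h h1 h2 h3 ih =>
    obtain ⟨l', rfl⟩ : ∃ l', l = x :: l' := by cases h <;> exact ⟨_, rfl⟩
    rw [edgesOf_cons_cons, edgesOf_cons_cons] at hp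
    simp only [List.mem_cons, Prod.mk.injEq] at hp
    rcases hp with ⟨rfl, rfl⟩ | ⟨rfl, rfl⟩ | hp
    · simp [pairs]
    · exact .inr h3
    · refine (ih hp).imp (fun h => ?_) id
      rw [pairs]
      exact List.mem_cons_of_mem _ h

/-- The popularity inequality for a zigzag: the endpoints of its `(+,+)` edges are
outnumbered by the `M`-partners of its ends lying outside of it. -/
theorem ZigZag.ncard_le [Fintype A] [Fintype B] (hP : P.Popular M) (h : ZigZag P M x t l)
    (hn : l.Nodup) :
    {p | ∃ q, ((p, q) ∈ pairs l ∨ (q, p) ∈ pairs l) ∧ P.vPlusPlus M p q}.ncard ≤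
      {y | y ∉ l ∧ (vInM M x y ∨ vInM M t y)}.ncard := by
  refine (hP.ncard_plusPlus_le (fun p q => (p, q) ∈ pairs l ∨ (q, p) ∈ pairs l)
    (fun _ _ => Or.symm) (fun _ _ _ => pairs_unique hn) ?_).trans ?_
  · rintro p q (hp | hp)
    · exact h.mem_pairs hp
    · have := h.mem_pairs hp
      exact ⟨vAdjGM_symm this.1, fun h => this.2 (vInM_symm h)⟩
  · refine Set.ncard_le_ncard ?_
    rintro y ⟨hy, w, hw, u, hu⟩
    have hyl : y ∉ l := fun hyl => hy (h.exists_pair hyl)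
    have hwl : w ∈ l := by
      rcases hu with hu | hu
      · exact (mem_of_mem_pairs hu).1
      · exact (mem_of_mem_pairs hu).2
    have hw := vInM_symm hw
    rcases h.partner hP.1 hwl hw with rfl | rfl | h'
    · exact ⟨hyl, .inl hw⟩
    · exact ⟨hyl, .inr hw⟩
    · exact absurd h' hyl

theorem ncard_partner_le_one [Fintype A] [Fintype B] (hM : P.IsMatching M) (x : V A B) :
    {y | vInM M x y}.ncard ≤ 1 :=
  (Set.ncard_le_one).2 fun _ hy _ hz => hM.unique hy hz

/-- Following an alternating path from a non-matching edge up to a `(+,+)` edge. -/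
theorem exists_zigZag_of_mem_edgesOf {r t : V A B} (hrt : P.vPlusPlus M r t) :
    ∀ (l : List (V A B)) (x y : V A B), (x :: y :: l).IsChain (P.vAdjGM M) →
      (edgesOf (x :: y :: l)).IsChain (fun e f => vInM M e.1 e.2 ↔ ¬ vInM M f.1 f.2) →
      ¬ vInM M x y → (r, t) ∈ edgesOf (x :: y :: l) →
      ∃ l', ZigZag P M x t (x :: y :: l') ∧ l' <+: l ∧ (r, t) ∈ pairs (x :: y :: l')
  | l, x, y, hc, ha, hxy, hm => by
    rw [edgesOf_cons_cons, List.mem_cons, Prod.mk.injEq] at hm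
    rcases hm with ⟨rfl, rfl⟩ | hm
    · exact ⟨[], .pair hrt.vAdjGM hxy, List.nil_prefix, by simp [pairs]⟩
    · match l, hc, ha, hm with
      | [], _, _, hm => simp [edgesOf] at hm
      | [z], hc, ha, hm =>
        simp [edgesOf] at ha hm
        obtain ⟨rfl, rfl⟩ := hm
        exact absurd hrt.not_vInM (by tauto)
      | z :: w :: l, hc, ha, hm =>
        simp only [edgesOf_cons_cons, List.isChain_cons_cons] at ha hc hm
        have hyz : vInM M y z := by tauto
        have hzw : ¬ vInM M z w := by tauto
        obtain ⟨l', h1, h2, h3⟩ := exists_zigZag_of_mem_edgesOf hrt l z w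
          (by rw [List.isChain_cons_cons]; tauto) (by rw [edgesOf_cons_cons]; tauto) hzw (by
            rw [List.mem_cons, Prod.mk.injEq] at hm
            rcases hm with ⟨rfl, rfl⟩ | hm
            · exact absurd hyz hrt.not_vInM
            · exact hm)
        refine ⟨z :: w :: l', .cons h1 hc.1 hxy hyz, by simpa using h2, ?_⟩
        rw [pairs]
        exact List.mem_cons_of_mem _ h3

/-- An alternating path starting with a non-matching edge is a zigzag, up to one matching
edge at the end. -/
theorem zigZag_or_zigZag_append {x : V A B} {l : List (V A B)} (hl : (edgesOf l).IsChain
      (fun e f => vInM M e.1 e.2 ↔ ¬ vInM M f.1 f.2))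
    (hadj : ∀ e ∈ edgesOf l, P.vAdjGM M e.1 e.2) {y : V A B} {l₀ : List (V A B)}
    (hl₀ : l = x :: y :: l₀) (hxy : ¬ vInM M x y) :
    (∃ t, ZigZag P M x t l) ∨
      ∃ t c l', l = l' ++ [c] ∧ ZigZag P M x t l' ∧ vInM M t c := by
  match l₀ with
  | [] =>
    subst hl₀
    exact .inl ⟨y, .pair (hadj (x, y) (by simp [edgesOf])) hxy⟩
  | [z] =>
    subst hl₀
    refine .inr ⟨y, z, [x, y], rfl, .pair (hadj (x, y) (by simp [edgesOf])) hxy, ?_⟩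
    simp only [edgesOf_cons_cons, List.isChain_cons_cons] at hl
    tauto
  | z :: w :: l₁ =>
    subst hl₀
    have hadjxy := hadj (x, y) (by simp [edgesOf])
    simp only [edgesOf_cons_cons, List.isChain_cons_cons] at hl
    have hyz : vInM M y z := by tauto
    have hzw : ¬ vInM M z w := by tauto
    rcases zigZag_or_zigZag_append (l := z :: w :: l₁) (by rw [edgesOf_cons_cons]; tauto)
      (fun e he => hadj e (by simp only [edgesOf_cons_cons, List.mem_cons] at he ⊢; tauto))
      rfl hzw with ⟨t, ht⟩ | ⟨t, c, l', h1, h2, h3⟩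
    · exact .inl ⟨t, .cons ht hadjxy hxy hyz⟩
    · exact .inr ⟨t, c, x :: y :: l', by simp [h1], .cons h2 hadjxy hxy hyz, h3⟩
termination_by l.length
decreasing_by subst hl₀; simp

end ZigZag

section Necessity

variable {A B : Type} [Fintype A] [Fintype B] {P : PrefSys A B} {M : Finset (A × B)}

/-- A zigzag closed up by a matching edge has no `(+,+)` edge if `M` is popular. -/
theorem Popular.not_vPlusPlus_of_closed (hP : P.Popular M) {x t : V A B} {l : List (V A B)}
    (h : ZigZag P M x t l) (hn : l.Nodup) (hc : vInM M t x) {p q : V A B}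
    (hp : (p, q) ∈ edgesOf l) : ¬ P.vPlusPlus M p q := by
  intro hpq
  have hle := h.ncard_le hP hn
  have hpair := (h.mem_edgesOf hp).resolve_right hpq.not_vInM
  have h1 : 0 < {p | ∃ q, ((p, q) ∈ pairs l ∨ (q, p) ∈ pairs l) ∧ P.vPlusPlus M p q}.ncard :=
    (Set.ncard_pos).2 ⟨p, q, .inl hpair, hpq⟩
  obtain ⟨y, hy⟩ := (Set.ncard_pos).1 (h1.trans_le hle)
  rcases hy.2 with h' | h'
  · exact hy.1 (hP.1.unique h' (vInM_symm hc) ▸ h.last_mem)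
  · exact hy.1 (hP.1.unique h' hc ▸ h.first_mem)

theorem Popular.not_exists_altCycle (hP : P.Popular M) :
    ¬ ∃ v, P.IsAltCycle M v ∧ ∃ e ∈ cycEdgesOf v, P.vPlusPlus M e.1 e.2 := by
  rintro ⟨v, ⟨hn, hlen, hadj, halt⟩, ⟨p, q⟩, he, hpp⟩
  have hM := hP.1
  replace halt : List.IsChain _ _ := halt
  match v, hlen with
  | x :: y :: z :: l, _ =>
    rw [cycEdgesOf_cons] at *
    by_cases hxy : vInM M x y
    · have hyz : ¬ vInM M y z := by
        simp only [List.cons_append, edgesOf_cons_cons, List.isChain_cons_cons] at halt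
        tauto
      simp only [List.cons_append] at *
      rw [edgesOf_cons_cons] at *
      have hpq : (p, q) ∈ edgesOf (y :: z :: (l ++ [x])) := by
        rw [List.mem_cons, Prod.mk.injEq] at he
        rcases he with ⟨rfl, rfl⟩ | he
        · exact absurd hxy hpp.not_vInM
        · exact he
      rcases zigZag_or_zigZag_append halt.tail
        (fun e he => hadj e (List.mem_cons_of_mem _ he)) rfl hyz with
        ⟨t, ht⟩ | ⟨t, c, l', h1, h2, h3⟩
      · have htx : t = x := by
          have h := ht.getLast?
          rw [← List.cons_append, ← List.cons_append, List.getLast?_concat] at h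
          simpa using h.symm
        subst htx
        refine hP.not_vPlusPlus_of_closed ht ?_ hxy hpq hpp
        rw [← List.cons_append, ← List.cons_append]
        exact (List.perm_append_singleton t (y :: z :: l)).nodup_iff.2 hn
      · rw [← List.cons_append, ← List.cons_append] at h1
        obtain ⟨rfl, h1⟩ := List.append_inj' h1 rfl
        obtain rfl : x = c := by simpa using h1
        obtain rfl := hM.unique (vInM_symm h3) hxy
        exact h2.isLeft hM rfl
    · rcases zigZag_or_zigZag_append halt hadj rfl hxy with ⟨t, ht⟩ | ⟨t, c, l', h1, h2, h3⟩
      · have htx : t = x := by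
          have h := ht.getLast?
          rw [List.getLast?_concat] at h
          simpa using h.symm
        subst htx
        exact ht.isLeft hM rfl
      · obtain ⟨rfl, h1⟩ := List.append_inj' h1 rfl
        obtain rfl : x = c := by simpa using h1
        rw [edgesOf_concat x _ t h2.getLast?, List.mem_append] at he
        rcases he with he | he
        · exact hP.not_vPlusPlus_of_closed h2 hn h3 he hpp
        · simp only [List.mem_singleton, Prod.mk.injEq] at he
          obtain ⟨rfl, rfl⟩ := he
          exact hpp.not_vInM h3

theorem Popular.not_exists_altPath_unmatched (hP : P.Popular M) :
    ¬ ∃ v, P.IsAltPath M v ∧ (∀ x, v.head? = some x → ¬ vMatched M x) ∧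
      ∃ e ∈ edgesOf v, P.vPlusPlus M e.1 e.2 := by
  rintro ⟨v, ⟨hn, hc, ha⟩, hu, ⟨r, t⟩, he, hpp⟩
  match v with
  | [] => simp [edgesOf] at he
  | [_] => simp [edgesOf] at he
  | x :: y :: l =>
    have hx : ∀ y, ¬ vInM M x y := by
      simpa [vMatched_iff] using hu x
    obtain ⟨l', h1, h2, h3⟩ := exists_zigZag_of_mem_edgesOf hpp l x y hc ha (hx y) he
    have hn' : (x :: y :: l').Nodup := hn.sublist (by simpa using h2.sublist)
    have hle := h1.ncard_le hP hn'
    have hL : {z | z ∉ x :: y :: l' ∧ (vInM M x z ∨ vInM M t z)}.ncard ≤ 1 := by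
      refine (Set.ncard_le_ncard ?_).trans (ncard_partner_le_one hP.1 t)
      rintro z ⟨-, hz⟩
      exact hz.resolve_left (hx z)
    have hrt : r ≠ t := vAdj_ne (vPlusPlus_iff.1 hpp).1
    exact hrt ((Set.ncard_le_one).1 (hle.trans hL) r ⟨t, .inl h3, hpp⟩ t
      ⟨r, .inr h3, vPlusPlus_symm hpp⟩)

theorem Popular.not_exists_altPath_two (hP : P.Popular M) :
    ¬ ∃ v, P.IsAltPath M v ∧ ∃ l₁ l₂ l₃ e f, edgesOf v = l₁ ++ e :: l₂ ++ f :: l₃ ∧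
      P.vPlusPlus M e.1 e.2 ∧ P.vPlusPlus M f.1 f.2 := by
  rintro ⟨v, ⟨hn, hc, ha⟩, l₁, l₂, l₃, ⟨p, q⟩, ⟨r, t⟩, hv, hpq, hrt⟩
  replace hrt : P.vPlusPlus M r t := hrt
  rw [List.append_assoc, List.cons_append] at hv
  obtain ⟨v₁, v₂, rfl, h2, h3⟩ := exists_append_of_edgesOf_eq hv
  have hn := hn.of_append_right
  have hrt' : (r, t) ∈ edgesOf (q :: v₂) := by simp [h2]
  have htv : t ∈ v₂ := (List.of_mem_zip hrt').2
  obtain ⟨l', h4, h5, h6⟩ := exists_zigZag_of_mem_edgesOf hrt v₂ p q hc.right_of_append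
    (ha.suffix h3) hpq.not_vInM (by rw [edgesOf_cons_cons]; exact List.mem_cons_of_mem _ hrt')
  have hle := h4.ncard_le hP (hn.sublist (by simpa using h5.sublist))
  have hL : {z | z ∉ p :: q :: l' ∧ (vInM M p z ∨ vInM M t z)}.ncard ≤ 1 + 1 := by
    refine (Set.ncard_le_ncard ?_).trans ((Set.ncard_union_le _ _).trans
      (add_le_add (ncard_partner_le_one hP.1 p) (ncard_partner_le_one hP.1 t)))
    rintro z ⟨-, hz⟩
    exact hz
  have hS : ({p, q, t} : Set (V A B)) ⊆ {a |
      ∃ b, ((a, b) ∈ pairs (p :: q :: l') ∨ (b, a) ∈ pairs (p :: q :: l')) ∧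
        P.vPlusPlus M a b} := by
    rintro a (rfl | rfl | rfl)
    · exact ⟨q, by simp [pairs], hpq⟩
    · exact ⟨p, by simp [pairs], vPlusPlus_symm hpq⟩
    · exact ⟨r, .inr h6, vPlusPlus_symm hrt⟩
  have hcard : ({p, q, t} : Set (V A B)).ncard = 3 := by
    simp only [List.nodup_cons, List.mem_cons, not_or] at hn
    refine Set.ncard_eq_three.2 ⟨p, q, t, hn.1.1, ?_, ?_, rfl⟩
    · rintro rfl
      exact hn.1.2 htv
    · rintro rfl
      exact hn.2.1 htv
  have := Set.ncard_le_ncard hS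
  omega

end Necessity

section Sufficiency

variable {A B : Type} (P : PrefSys A B) (M M' : Finset (A × B))

/-- `Trail P M M' s s' x u l` says that `x :: u :: l` is an alternating list in `G_M`, ending
with the `(+,+)` edge `{s,s'}` of `M'`, whose edges outside `M` are in `M'` and, except
for the last one, are not labeled `(+,+)`. -/
inductive Trail (s s' : V A B) : V A B → V A B → List (V A B) → Prop
  | base : vInM M' s s' → P.vPlusPlus M s s' → Trail s s' s s' []
  | step {x u y z : V A B} {l : List (V A B)} : Trail s s' x u l → vInM M x y →
      y ∉ x :: u :: l → vInM M' y z → z ∉ x :: u :: l → P.vAdjGM M y z →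
      ¬ P.vPlusPlus M y z → Trail s s' z y (x :: u :: l)

variable {P M M'} {s s' x u : V A B} {l : List (V A B)}

theorem Trail.not_vInM_head (hM : P.IsMatching M) (h : Trail P M M' s s' x u l) :
    ¬ vInM M x u := by
  cases h with
  | base _ h => exact h.not_vInM
  | step _ h1 _ _ h2 =>
    intro h
    exact h2 (hM.unique (vInM_symm h1) (vInM_symm h) ▸ List.mem_cons_self)

theorem Trail.nodup (hM' : P.IsMatching M') (h : Trail P M M' s s' x u l) :
    (x :: u :: l).Nodup := by
  induction h with
  | base h => simpa using vAdj_ne (hM'.vAdj h)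
  | step _ _ h1 h2 h3 _ _ ih =>
    refine List.nodup_cons.2 ⟨?_, List.nodup_cons.2 ⟨h1, ih⟩⟩
    rw [List.mem_cons, not_or]
    exact ⟨(vAdj_ne (hM'.vAdj h2)).symm, h3⟩

theorem Trail.isChain (hM : P.IsMatching M) (h : Trail P M M' s s' x u l) :
    (x :: u :: l).IsChain (P.vAdjGM M) := by
  induction h with
  | base _ h => simpa using h.vAdjGM
  | step _ h1 _ _ _ h2 _ ih =>
    exact .cons_cons (vAdjGM_symm h2) (.cons_cons (vAdjGM_symm (hM.vAdjGM h1)) ih)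

theorem Trail.isChain_edgesOf (hM : P.IsMatching M) (h : Trail P M M' s s' x u l) :
    (edgesOf (x :: u :: l)).IsChain (fun e f => vInM M e.1 e.2 ↔ ¬ vInM M f.1 f.2) := by
  induction h with
  | base => simp [edgesOf]
  | step h h1 h2 h3 h4 h5 h6 ih =>
    rw [edgesOf_cons_cons] at ih
    rw [edgesOf_cons_cons, edgesOf_cons_cons, edgesOf_cons_cons]
    have h7 := (Trail.step h h1 h2 h3 h4 h5 h6).not_vInM_head hM
    have h8 := h.not_vInM_head hM
    have h9 := vInM_symm h1
    exact .cons_cons (by tauto) (.cons_cons (by tauto) ih)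

theorem Trail.isAltPath (hM : P.IsMatching M) (hM' : P.IsMatching M')
    (h : Trail P M M' s s' x u l) : P.IsAltPath M (x :: u :: l) :=
  ⟨h.nodup hM', h.isChain hM, h.isChain_edgesOf hM⟩

theorem Trail.edgesOf_eq (h : Trail P M M' s s' x u l) :
    ∃ l₁, edgesOf (x :: u :: l) = l₁ ++ [(s, s')] := by
  induction h with
  | base => exact ⟨[], rfl⟩
  | step _ _ _ _ _ _ _ ih =>
    obtain ⟨l₁, h⟩ := ih
    rw [edgesOf_cons_cons, edgesOf_cons_cons, h]
    exact ⟨_ :: _ :: l₁, rfl⟩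

theorem Trail.getLast? (h : Trail P M M' s s' x u l) : (x :: u :: l).getLast? = some s' := by
  induction h with
  | base => rfl
  | step _ _ _ _ _ _ _ ih => simpa [List.getLast?_cons] using ih

theorem Trail.vPlusPlus (h : Trail P M M' s s' x u l) : P.vPlusPlus M s s' := by
  induction h with
  | base _ h => exact h
  | step _ _ _ _ _ _ _ ih => exact ih

theorem Trail.partner' (hM' : P.IsMatching M') (h : Trail P M M' s s' x u l) {w v : V A B}
    (hw : w ∈ x :: u :: l) (hv : vInM M' w v) : v ∈ x :: u :: l := by
  induction h with
  | base h =>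
    simp only [List.mem_cons, List.not_mem_nil, or_false] at hw
    rcases hw with rfl | rfl
    · simp [hM'.unique hv h]
    · simp [hM'.unique hv (vInM_symm h)]
  | step _ _ _ h _ _ _ ih =>
    rw [List.mem_cons, List.mem_cons] at hw
    rcases hw with rfl | rfl | hw
    · simp [hM'.unique hv (vInM_symm h)]
    · simp [hM'.unique hv h]
    · exact List.mem_cons_of_mem _ (List.mem_cons_of_mem _ (ih hw))

theorem Trail.partner (hM : P.IsMatching M) (h : Trail P M M' s s' x u l) {w v : V A B}
    (hw : w ∈ x :: u :: l) (hv : vInM M w v) : w = x ∨ w = s' ∨ v ∈ u :: l := by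
  induction h with
  | base h =>
    simp only [List.mem_cons, List.not_mem_nil, or_false] at hw
    tauto
  | step _ h _ _ _ _ _ ih =>
    rw [List.mem_cons, List.mem_cons] at hw
    rcases hw with rfl | rfl | hw
    · exact .inl rfl
    · simp [hM.unique hv (vInM_symm h)]
    · rcases ih hw with rfl | h' | h'
      · simp [hM.unique hv h]
      · exact .inr (.inl h')
      · exact .inr (.inr (List.mem_cons_of_mem _ (List.mem_cons_of_mem _ h')))

theorem Trail.unique (hM : P.IsMatching M) (hM' : P.IsMatching M')
    (h : Trail P M M' s s' x u l) : ∀ {r r' u' : V A B} {l' : List (V A B)},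
    Trail P M M' r r' x u' l' → s = r := by
  induction h with
  | base h1 h2 =>
    intro r r' u' l' h'
    cases h' with
    | base => rfl
    | step _ _ _ h3 _ _ h4 =>
      obtain rfl := hM'.unique h1 (vInM_symm h3)
      exact absurd (vPlusPlus_symm h2) h4
  | step _ g1 _ g3 _ _ g4 ih =>
    intro r r' u' l' h'
    cases h' with
    | base h1 h2 =>
      obtain rfl := hM'.unique h1 (vInM_symm g3)
      exact absurd (vPlusPlus_symm h2) g4
    | step h f1 _ f3 _ _ f4 =>
      obtain rfl := hM'.unique (vInM_symm g3) (vInM_symm f3)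
      obtain rfl := hM.unique (vInM_symm g1) (vInM_symm f1)
      exact ih h

/-- A trail either reaches a vertex losing in `M'` whose `M'`-partner does not win, or can be
extended, provided that the forbidden structures are absent. -/
theorem Trail.exists_step (hM : P.IsMatching M) (hM' : P.IsMatching M')
    (hcyc : ¬ ∃ v, P.IsAltCycle M v ∧ ∃ e ∈ cycEdgesOf v, P.vPlusPlus M e.1 e.2)
    (hunm : ¬ ∃ v, P.IsAltPath M v ∧ (∀ x, v.head? = some x → ¬ vMatched M x) ∧
      ∃ e ∈ edgesOf v, P.vPlusPlus M e.1 e.2)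
    (htwo : ¬ ∃ v, P.IsAltPath M v ∧ ∃ l₁ l₂ l₃ e f, edgesOf v = l₁ ++ e :: l₂ ++ f :: l₃ ∧
      P.vPlusPlus M e.1 e.2 ∧ P.vPlusPlus M f.1 f.2)
    (h : Trail P M M' s s' x u l) :
    (∃ y, vInM M x y ∧ P.vPref M M' y ∧ ∀ z, vInM M' y z → ¬ P.vPref M' M z) ∨
      ∃ z y, Trail P M M' s s' z y (x :: u :: l) := by
  have hpath := h.isAltPath hM hM'
  obtain ⟨l₁, hl₁⟩ := h.edgesOf_eq
  have hpp := h.vPlusPlus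
  obtain ⟨y, hxy⟩ : ∃ y, vInM M x y := by
    by_contra hx
    refine hunm ⟨_, hpath, fun w hw => ?_, (s, s'), by simp [hl₁], hpp⟩
    obtain rfl : x = w := by simpa using hw
    rwa [vMatched_iff]
  have hy : y ∉ x :: u :: l := by
    intro hy
    rcases h.partner hM hy (vInM_symm hxy) with rfl | rfl | hx
    · exact vAdj_ne (hM.vAdj hxy) rfl
    · have hcl : cycEdgesOf (x :: u :: l) = edgesOf (x :: u :: l) ++ [(y, x)] := by
        rw [cycEdgesOf, h.getLast?]
        rfl
      refine hcyc ⟨_, ⟨hpath.1, ?_, ?_, ?_⟩, (s, y), by simp [hcl, hl₁], hpp⟩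
      · cases h with
        | base => exact absurd hxy hpp.not_vInM
        | step => simp
      · intro e he
        rw [hcl, List.mem_append, List.mem_singleton] at he
        rcases he with he | rfl
        · exact rel_of_mem_edgesOf hpath.2.1 he
        · exact hM.vAdjGM (vInM_symm hxy)
      · rw [hcl]
        refine List.IsChain.append hpath.2.2 (List.isChain_singleton _) ?_
        intro e he f hf
        rw [hl₁, List.getLast?_concat] at he
        simp only [Option.mem_def, Option.some.injEq, List.head?_cons] at he hf
        subst he hf
        have h1 := hpp.not_vInM
        have h2 := vInM_symm hxy
        tauto
    · exact (List.nodup_cons.1 hpath.1).1 hx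
  by_cases hT : P.vPref M M' y ∧ ∀ z, vInM M' y z → ¬ P.vPref M' M z
  · exact .inl ⟨y, hxy, hT⟩
  right
  obtain ⟨z, hyz, hor⟩ : ∃ z, vInM M' y z ∧ (P.vPref M' M y ∨ P.vPref M' M z) := by
    by_cases hz : ∃ z, vInM M' y z
    · obtain ⟨z, hz⟩ := hz
      refine ⟨z, hz, ?_⟩
      have hn : ¬ vInM M y z := fun hn => by
        obtain rfl := hM.unique hn (vInM_symm hxy)
        exact hy (h.partner' hM' List.mem_cons_self (vInM_symm hz))
      rcases vPref_or_vPref hM hM' hz hn with h1 | h1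
      · exact .inl h1
      · right
        by_contra h2
        exact hT ⟨h1, fun w hw => hM'.unique hz hw ▸ h2⟩
    · refine absurd ⟨⟨x, vInM_symm hxy, fun w hw => absurd ⟨w, hw⟩ hz⟩, fun z h => ?_⟩ hT
      exact absurd ⟨z, h⟩ hz
  have hz : z ∉ x :: u :: l := fun hz => hy (h.partner' hM' hz (vInM_symm hyz))
  have hadj : P.vAdjGM M y z := by
    refine vAdjGM_iff.2 ⟨hM'.vAdj hyz, .inr ?_⟩
    exact hor.imp (vVote_of_vPref hM' hyz) (vVote_of_vPref hM' (vInM_symm hyz))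
  refine ⟨z, y, .step h hxy hy hyz hz hadj fun hpp' => htwo ?_⟩
  have hn : ¬ vInM M y z := hpp'.not_vInM
  refine ⟨z :: y :: x :: u :: l, ⟨?_, ?_, ?_⟩, [], (y, x) :: l₁, [], (z, y), (s, s'), ?_,
    vPlusPlus_symm hpp', hpp⟩
  · refine List.nodup_cons.2 ⟨?_, List.nodup_cons.2 ⟨hy, hpath.1⟩⟩
    rw [List.mem_cons, not_or]
    exact ⟨(vAdj_ne (hM'.vAdj hyz)).symm, hz⟩
  · exact .cons_cons (vAdjGM_symm hadj) (.cons_cons (hM.vAdjGM (vInM_symm hxy)) hpath.2.1)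
  · have h1 := hpath.2.2
    rw [edgesOf_cons_cons] at h1
    rw [edgesOf_cons_cons, edgesOf_cons_cons, edgesOf_cons_cons]
    have h2 := h.not_vInM_head hM
    have h3 := vInM_symm hxy
    have h4 : ¬ vInM M z y := fun h => hn (vInM_symm h)
    exact .cons_cons (by tauto) (.cons_cons (by tauto) h1)
  · rw [edgesOf_cons_cons, edgesOf_cons_cons, hl₁]
    simp

/-- Every endpoint of a `(+,+)` edge of `M'` starts a trail reaching a vertex losing in `M'`
whose `M'`-partner does not win. -/
theorem exists_trail [Finite A] [Finite B] (hM : P.IsMatching M) (hM' : P.IsMatching M')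
    (hcyc : ¬ ∃ v, P.IsAltCycle M v ∧ ∃ e ∈ cycEdgesOf v, P.vPlusPlus M e.1 e.2)
    (hunm : ¬ ∃ v, P.IsAltPath M v ∧ (∀ x, v.head? = some x → ¬ vMatched M x) ∧
      ∃ e ∈ edgesOf v, P.vPlusPlus M e.1 e.2)
    (htwo : ¬ ∃ v, P.IsAltPath M v ∧ ∃ l₁ l₂ l₃ e f, edgesOf v = l₁ ++ e :: l₂ ++ f :: l₃ ∧
      P.vPlusPlus M e.1 e.2 ∧ P.vPlusPlus M f.1 f.2)
    (hs : vInM M' s s') (hpp : P.vPlusPlus M s s') :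
    ∃ y x u l, Trail P M M' s s' x u l ∧ vInM M x y ∧ P.vPref M M' y ∧
      ∀ z, vInM M' y z → ¬ P.vPref M' M z := by
  by_contra hcon
  have hlong : ∀ n : ℕ, ∃ x u l, Trail P M M' s s' x u l ∧ n ≤ l.length := by
    intro n
    induction n with
    | zero => exact ⟨s, s', [], .base hs hpp, le_rfl⟩
    | succ n ih =>
      obtain ⟨x, u, l, h, hn⟩ := ih
      rcases h.exists_step hM hM' hcyc hunm htwo with ⟨y, hy⟩ | ⟨z, y, h'⟩
      · exact absurd ⟨y, x, u, l, h, hy⟩ hcon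
      · exact ⟨z, y, _, h', by simp only [List.length_cons]; omega⟩
  have := Fintype.ofFinite (V A B)
  obtain ⟨x, u, l, h, hn⟩ := hlong (Fintype.card (V A B))
  have := (h.nodup hM').length_le_card
  simp only [List.length_cons] at this
  omega

theorem popular_of_not_exists [Fintype A] [Fintype B] (hM : P.IsMatching M)
    (hcyc : ¬ ∃ v, P.IsAltCycle M v ∧ ∃ e ∈ cycEdgesOf v, P.vPlusPlus M e.1 e.2)
    (hunm : ¬ ∃ v, P.IsAltPath M v ∧ (∀ x, v.head? = some x → ¬ vMatched M x) ∧
      ∃ e ∈ edgesOf v, P.vPlusPlus M e.1 e.2)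
    (htwo : ¬ ∃ v, P.IsAltPath M v ∧ ∃ l₁ l₂ l₃ e f, edgesOf v = l₁ ++ e :: l₂ ++ f :: l₃ ∧
      P.vPlusPlus M e.1 e.2 ∧ P.vPlusPlus M f.1 f.2) :
    P.Popular M := by
  refine ⟨hM, fun M' hM' => ?_⟩
  rw [phi_eq_ncard_vPref, phi_eq_ncard_vPref]
  refine ncard_le_ncard_of_rel
    (fun s y => (vInM M' s y ∧ P.vPref M' M s) ∨
      (∃ s' x u l, Trail P M M' s s' x u l ∧ vInM M x y) ∧
        ∀ z, vInM M' y z → ¬ P.vPref M' M z) ?_ ?_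
  · intro s hs
    obtain ⟨s', hss', hv⟩ := id hs
    have hn : ¬ vInM M s s' := fun h => lt_irrefl _ (hv s' h)
    rcases vPref_or_vPref hM hM' (vInM_symm hss') (fun h => hn (vInM_symm h)) with h' | h'
    · have hpp : P.vPlusPlus M s s' := vPlusPlus_iff.2
        ⟨hM'.vAdj hss', hn, hv, vVote_of_vPref hM' (vInM_symm hss') h'⟩
      obtain ⟨y, x, u, l, h1, h2, h3, h4⟩ := exists_trail hM hM' hcyc hunm htwo hss' hpp
      exact ⟨y, h3, .inr ⟨⟨s', x, u, l, h1, h2⟩, h4⟩⟩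
    · exact ⟨s', h', .inl ⟨hss', hs⟩⟩
  · rintro s r y (⟨h1, h2⟩ | ⟨⟨s', x, u, l, h1, h2⟩, h3⟩)
      (⟨g1, g2⟩ | ⟨⟨r', x', u', l', g1, g2⟩, g3⟩)
    · exact hM'.unique (vInM_symm h1) (vInM_symm g1)
    · exact absurd h2 (g3 s (vInM_symm h1))
    · exact absurd g2 (h3 r (vInM_symm g1))
    · obtain rfl := hM.unique (vInM_symm h2) (vInM_symm g2)
      exact h1.unique hM hM' g1

end Sufficiency

end PrefSys

open PrefSys in
/-- a matching `M` is popular iff `G_M` has (i) no alternating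
cycle containing a `(+,+)` edge, (ii) no alternating path from a vertex
unmatched in `M` containing a `(+,+)` edge, and (iii) no alternating path
containing two or more `(+,+)` edges. -/
theorem popular_characterization {A B : Type} [Fintype A] [Fintype B]
    (P : PrefSys A B) (M : Finset (A × B)) (hM : P.IsMatching M) :
    P.Popular M ↔
      ((¬ ∃ v, P.IsAltCycle M v ∧ ∃ e ∈ cycEdgesOf v, P.vPlusPlus M e.1 e.2) ∧
       (¬ ∃ v, P.IsAltPath M v ∧ (∀ x, v.head? = some x → ¬ vMatched M x) ∧
          ∃ e ∈ edgesOf v, P.vPlusPlus M e.1 e.2) ∧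
       (¬ ∃ v, P.IsAltPath M v ∧ ∃ l₁ l₂ l₃ e f, edgesOf v = l₁ ++ e :: l₂ ++ f :: l₃ ∧
          P.vPlusPlus M e.1 e.2 ∧ P.vPlusPlus M f.1 f.2)) := by
  exact ⟨fun h => ⟨h.not_exists_altCycle, h.not_exists_altPath_unmatched,
    h.not_exists_altPath_two⟩, fun ⟨h1, h2, h3⟩ => popular_of_not_exists hM h1 h2 h3⟩
end

section
/- If there exists a popular matching in G containing a given edge e*, then there exists either a stable matching in G containing e* or a dominant matching in G containing e*. -/
open Classical

/-- Total weight of the arcs traversed by a list of nodes. -/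
def walkWeight {V : Type} (w : V → V → ℤ) : List V → ℤ
  | [] => 0
  | [_] => 0
  | x :: y :: l => w x y + walkWeight w (y :: l)

theorem walkWeight_append {V : Type} (w : V → V → ℤ) (x : V) (s t : List V) :
    walkWeight w (s ++ x :: t) = walkWeight w (s ++ [x]) + walkWeight w (x :: t) := by
  induction s with
  | nil => simp [walkWeight]
  | cons y s ih => cases s <;> (simp_all [walkWeight]; try ring)

/-- A simple cycle is realized by a permutation fixing the nodes off the cycle. -/
theorem exists_perm_of_nodup {V : Type} [Fintype V] (w : V → V → ℤ) (hd : ∀ v, w v v = 0)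
    (x : V) (l : List V) (hn : (x :: l).Nodup) :
    ∃ σ : Equiv.Perm V, ∃ z, σ z = x ∧ z ∈ x :: l ∧ (∀ v, v ∉ x :: l → σ v = v) ∧
      (∀ y, walkWeight w (x :: l ++ [y]) = walkWeight w (x :: l) + w z y) ∧
      ∑ v, w v (σ v) = walkWeight w (x :: l) + w z x := by
  induction l generalizing x with
  | nil => exact ⟨1, x, by simp [walkWeight, hd]⟩
  | cons y l ih =>
    obtain ⟨σ, z, hz, hzl, hfix, hend, hsum⟩ := ih y (List.nodup_cons.1 hn).2
    have hx : x ∉ y :: l := (List.nodup_cons.1 hn).1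
    have hzx : z ≠ x := fun h => hx (h ▸ hzl)
    have hxy : x ≠ y := fun h => hx (by simp [h])
    have hσx : σ x = x := hfix x hx
    refine ⟨Equiv.swap x y * σ, z, by simp [hz], List.mem_cons_of_mem _ hzl, ?_, ?_, ?_⟩
    · intro v hv
      have h1 : v ≠ x := fun h => hv (by simp [h])
      have h2 : v ≠ y := fun h => hv (by simp [h])
      have h3 : σ v = v := hfix v fun h => hv (List.mem_cons_of_mem _ h)
      simp [h3, Equiv.swap_apply_of_ne_of_ne h1 h2]
    · intro t
      have := hend t
      simp only [List.cons_append, walkWeight] at this ⊢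
      linarith
    · have key : ∀ v, w v ((Equiv.swap x y * σ) v) = w v (σ v) +
          ((if v = x then w x y else 0) + (if v = z then w z x - w z y else 0)) := by
        intro v
        by_cases h1 : v = x
        · subst h1
          simp [hσx, hzx.symm, hd]
        · by_cases h2 : v = z
          · subst h2
            simp [hz, h1]
          · have h3 : σ v ≠ x := fun h => h1 (σ.injective (h.trans hσx.symm))
            have h4 : σ v ≠ y := fun h => h2 (σ.injective (h.trans hz.symm))
            simp [h1, h2, Equiv.swap_apply_of_ne_of_ne h3 h4]
      simp only [key, Finset.sum_add_distrib, hsum, walkWeight, Finset.sum_ite_eq',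
        Finset.mem_univ, if_true]
      ring

/-- If no permutation has positive weight then the arc weights admit a potential. -/
theorem exists_potential {V : Type} [Fintype V] (w : V → V → ℤ) (hd : ∀ v, 0 ≤ w v v)
    (hs : ∀ σ : Equiv.Perm V, ∑ v, w v (σ v) ≤ 0) :
    ∃ q : V → ℤ, ∀ u v, w u v + q v ≤ q u := by
  have hd0 : ∀ v, w v v = 0 := fun v => by
    have h1 := hs 1
    have h2 := Finset.single_le_sum (f := fun v => w v v) (fun v _ => hd v) (Finset.mem_univ v)
    have h3 := hd v
    simp only [Equiv.Perm.coe_one, id_eq] at h1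
    linarith
  have hmax : ∀ u, ∃ l : List V, (u :: l).Nodup ∧
      ∀ l' : List V, (u :: l').Nodup → walkWeight w (u :: l') ≤ walkWeight w (u :: l) := by
    intro u
    have hfin : {l : List V | (u :: l).Nodup}.Finite := by
      have : {l : List V | l.Nodup}.Finite :=
        (List.finite_length_le V (Fintype.card V)).subset fun l hl => hl.length_le_card
      exact this.subset fun l hl => (List.nodup_cons.1 hl).2
    obtain ⟨l, hl, hl'⟩ := Set.exists_max_image _ (fun l => walkWeight w (u :: l)) hfin
      ⟨[], by simp⟩
    exact ⟨l, hl, hl'⟩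
  choose L hL hLmax using hmax
  refine ⟨fun u => walkWeight w (u :: L u), fun u v => ?_⟩
  by_cases huv : u = v
  · subst huv
    simp [hd0]
  by_cases hu : u ∈ L v
  · obtain ⟨s, t, hst⟩ := List.append_of_mem hu
    have hn := hL v
    rw [hst] at hn
    have hn' : (u :: t).Nodup := List.Nodup.sublist
      (((List.sublist_append_right s (u :: t))).cons v) hn
    have hc : (u :: v :: s).Nodup := by
      simp only [List.nodup_cons, List.nodup_append, List.mem_append, List.mem_cons] at hn ⊢
      grind
    obtain ⟨σ, z, -, -, -, hend, hsum⟩ := exists_perm_of_nodup w hd0 u (v :: s) hc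
    have h1 := hs σ
    have h2 := hend u
    have h3 := walkWeight_append w u (v :: s) t
    have h4 := hLmax u t hn'
    simp only [hst]
    simp only [List.cons_append, walkWeight] at h1 h2 h3 hsum ⊢
    linarith
  · have h1 : (u :: v :: L v).Nodup := List.nodup_cons.2 ⟨by simp [huv, hu], hL v⟩
    exact hLmax u _ h1

/-- Existence of stable sets of contracts: `f` and `g` give the two parties of a contract, and
each party ranks its contracts by `r` and `s` respectively. -/
theorem exists_stable_contracts {X Y Z R : Type} [LinearOrder R] (f : X → Y) (g : X → Z)
    (r s : X → R) (C : Finset X)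
    (hr : ∀ x ∈ C, ∀ y ∈ C, f x = f y → r x = r y → x = y)
    (hs : ∀ x ∈ C, ∀ y ∈ C, g x = g y → s x = s y → x = y) :
    ∃ S ⊆ C, (∀ x ∈ S, ∀ y ∈ S, f x = f y → x = y) ∧ (∀ x ∈ S, ∀ y ∈ S, g x = g y → x = y) ∧
      ∀ x ∈ C, x ∉ S → (∃ y ∈ S, f y = f x ∧ r y < r x) ∨ (∃ y ∈ S, g y = g x ∧ s y < s x) := by
  induction hn : C.card generalizing C with
  | zero => exact ⟨∅, by simp, by simp, by simp, by simp [Finset.card_eq_zero.1 hn]⟩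
  | succ n ih =>
    set T := C.filter fun x => ∀ y ∈ C, f y = f x → r x ≤ r y with hT
    by_cases hg : ∀ x ∈ T, ∀ y ∈ T, g x = g y → x = y
    · refine ⟨T, Finset.filter_subset _ _, ?_, hg, ?_⟩
      · intro x hx y hy hxy
        rw [hT, Finset.mem_filter] at hx hy
        exact hr x hx.1 y hy.1 hxy (le_antisymm (hx.2 y hy.1 hxy.symm) (hy.2 x hx.1 hxy))
      · intro x hx hxT
        left
        obtain ⟨y, hy, hmin⟩ := Finset.exists_min_image (C.filter fun y => f y = f x) r
          ⟨x, by simp [hx]⟩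
        rw [Finset.mem_filter] at hy
        have hyT : y ∈ T := Finset.mem_filter.2 ⟨hy.1, fun z hz hzy =>
          hmin z (Finset.mem_filter.2 ⟨hz, hzy.trans hy.2⟩)⟩
        refine ⟨y, hyT, hy.2, lt_of_le_of_ne (hmin x (by simp [hx])) fun h => ?_⟩
        exact hxT (hr y hy.1 x hx hy.2 h ▸ hyT)
    · have : ∃ x ∈ T, ∃ y ∈ T, g x = g y ∧ s x < s y := by
        push Not at hg
        obtain ⟨x, hx, y, hy, hxy, hne⟩ := hg
        rcases lt_trichotomy (s x) (s y) with h | h | h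
        · exact ⟨x, hx, y, hy, hxy, h⟩
        · exact absurd (hs x (Finset.mem_of_mem_filter x hx) y (Finset.mem_of_mem_filter y hy) hxy h) hne
        · exact ⟨y, hy, x, hx, hxy.symm, h⟩
      obtain ⟨x, hx, y, hy, hxy, hlt⟩ := this
      rw [hT, Finset.mem_filter] at hx hy
      obtain ⟨S, hSC, hSf, hSg, hS⟩ := ih (C.erase y)
        (fun x hx y hy => hr x (Finset.mem_of_mem_erase hx) y (Finset.mem_of_mem_erase hy))
        (fun x hx y hy => hs x (Finset.mem_of_mem_erase hx) y (Finset.mem_of_mem_erase hy)) (by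
        rw [Finset.card_erase_of_mem hy.1, hn]; rfl)
      refine ⟨S, hSC.trans (Finset.erase_subset _ _), hSf, hSg, fun z hz hzS => ?_⟩
      by_cases hzy : z = y
      · subst hzy
        right
        by_cases hxS : x ∈ S
        · exact ⟨x, hxS, hxy, hlt⟩
        · have hxz : x ≠ z := fun h => by simp [h] at hlt
          rcases hS x (Finset.mem_erase.2 ⟨hxz, hx.1⟩) hxS with ⟨t, ht, h1, h2⟩ | ⟨t, ht, h1, h2⟩
          · exact absurd h2 (not_lt.2 (hx.2 t (Finset.mem_of_mem_erase (hSC ht)) h1))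
          · exact ⟨t, ht, h1.trans hxy, h2.trans hlt⟩
      · exact hS z (Finset.mem_erase.2 ⟨hzy, hz⟩) hzS

namespace PrefSys

variable {A B : Type} {P : PrefSys A B} {M M' : Finset (A × B)} {a a' : A} {b b' : B}

theorem IsMatching.right_unique (hM : P.IsMatching M) (h : (a, b) ∈ M) (h' : (a, b') ∈ M) :
    b = b' :=
  congrArg Prod.snd (hM.2.1 _ h _ h' rfl)

theorem IsMatching.left_unique (hM : P.IsMatching M) (h : (a, b) ∈ M) (hk : (a', b) ∈ M) :
    a = a' :=
  congrArg Prod.fst (hM.2.2 _ h _ hk rfl)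

/-- The vote of `a` on the edge `(a, b)` versus its `M`-partner. -/
noncomputable def voteA (P : PrefSys A B) (M : Finset (A × B)) (a : A) (b : B) : ℤ :=
  if (a, b) ∈ M then 0 else if P.voteAplus M a b then 1 else -1

/-- The vote of `b` on the edge `(a, b)` versus its `M`-partner. -/
noncomputable def voteB (P : PrefSys A B) (M : Finset (A × B)) (a : A) (b : B) : ℤ :=
  if (a, b) ∈ M then 0 else if P.voteBplus M a b then 1 else -1

/-- The vote of `a` in the election of `M'` against `M`. -/
noncomputable def netA (P : PrefSys A B) (M' M : Finset (A × B)) (a : A) : ℤ :=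
  (if P.prefA M' M a then 1 else 0) - (if P.prefA M M' a then 1 else 0)

/-- The vote of `b` in the election of `M'` against `M`. -/
noncomputable def netB (P : PrefSys A B) (M' M : Finset (A × B)) (b : B) : ℤ :=
  (if P.prefB M' M b then 1 else 0) - (if P.prefB M M' b then 1 else 0)

theorem phi_sub_phi [Fintype A] [Fintype B] (P : PrefSys A B) (M M' : Finset (A × B)) :
    (P.phi M' M : ℤ) - P.phi M M' = ∑ a, P.netA M' M a + ∑ b, P.netB M' M b := by
  simp only [phi, netA, netB, Nat.card_eq_fintype_card, Fintype.card_subtype,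
    Finset.sum_sub_distrib, Finset.sum_boole]
  push_cast
  ring

theorem netA_of_mem (hM : P.IsMatching M) (hM' : P.IsMatching M') (h : (a, b) ∈ M') :
    P.netA M' M a = P.voteA M a b := by
  have h1 : P.prefA M' M a ↔ P.voteAplus M a b :=
    ⟨fun ⟨c, hc, hlt⟩ => hM'.right_unique hc h ▸ hlt, fun hv => ⟨b, h, hv⟩⟩
  have h2 : P.prefA M M' a ↔ ∃ c, (a, c) ∈ M ∧ P.rankA a c < P.rankA a b := by
    refine ⟨fun ⟨c, hc, hlt⟩ => ⟨c, hc, hlt b h⟩, fun ⟨c, hc, hlt⟩ => ⟨c, hc, fun d hd => ?_⟩⟩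
    rwa [hM'.right_unique hd h]
  unfold netA voteA
  by_cases hb : (a, b) ∈ M
  · have h3 : ¬ P.prefA M' M a := fun hp => lt_irrefl _ (h1.1 hp b hb)
    have h4 : ¬ P.prefA M M' a := fun hp => by
      obtain ⟨c, hc, hlt⟩ := h2.1 hp
      exact absurd hlt (by simp [hM.right_unique hc hb])
    simp [h3, h4, hb]
  · by_cases hv : P.voteAplus M a b
    · have h4 : ¬ P.prefA M M' a := fun hp => by
        obtain ⟨c, hc, hlt⟩ := h2.1 hp
        exact absurd (hv c hc) (not_lt.2 hlt.le)
      simp [h1.2 hv, h4, hb, hv]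
    · have h3 : ¬ P.prefA M' M a := fun hp => hv (h1.1 hp)
      have h4 : P.prefA M M' a := by
        rw [h2]
        simp only [voteAplus] at hv
        push Not at hv
        obtain ⟨c, hc, hle⟩ := hv
        refine ⟨c, hc, lt_of_le_of_ne hle fun heq => hb ?_⟩
        rwa [← P.rankA_inj a c b (hM.1 _ hc) (hM'.1 _ h) heq]
      simp [h3, h4, hb, hv]

theorem netB_of_mem (hM : P.IsMatching M) (hM' : P.IsMatching M') (h : (a, b) ∈ M') :
    P.netB M' M b = P.voteB M a b := by
  have h1 : P.prefB M' M b ↔ P.voteBplus M a b :=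
    ⟨fun ⟨c, hc, hlt⟩ => hM'.left_unique hc h ▸ hlt, fun hv => ⟨a, h, hv⟩⟩
  have h2 : P.prefB M M' b ↔ ∃ c, (c, b) ∈ M ∧ P.rankB b c < P.rankB b a := by
    refine ⟨fun ⟨c, hc, hlt⟩ => ⟨c, hc, hlt a h⟩, fun ⟨c, hc, hlt⟩ => ⟨c, hc, fun d hd => ?_⟩⟩
    rwa [hM'.left_unique hd h]
  unfold netB voteB
  by_cases hb : (a, b) ∈ M
  · have h3 : ¬ P.prefB M' M b := fun hp => lt_irrefl _ (h1.1 hp a hb)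
    have h4 : ¬ P.prefB M M' b := fun hp => by
      obtain ⟨c, hc, hlt⟩ := h2.1 hp
      exact absurd hlt (by simp [hM.left_unique hc hb])
    simp [h3, h4, hb]
  · by_cases hv : P.voteBplus M a b
    · have h4 : ¬ P.prefB M M' b := fun hp => by
        obtain ⟨c, hc, hlt⟩ := h2.1 hp
        exact absurd (hv c hc) (not_lt.2 hlt.le)
      simp [h1.2 hv, h4, hb, hv]
    · have h3 : ¬ P.prefB M' M b := fun hp => hv (h1.1 hp)
      have h4 : P.prefB M M' b := by
        rw [h2]
        simp only [voteBplus] at hv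
        push Not at hv
        obtain ⟨c, hc, hle⟩ := hv
        refine ⟨c, hc, lt_of_le_of_ne hle fun heq => hb ?_⟩
        rwa [← P.rankB_inj b c a (hM.1 _ hc) (hM'.1 _ h) heq]
      simp [h3, h4, hb, hv]

theorem netA_of_free (h : ∀ b, (a, b) ∉ M') :
    P.netA M' M a = if ∃ b, (a, b) ∈ M then -1 else 0 := by
  simp [netA, prefA, h]
  split_ifs <;> rfl

theorem netB_of_free (h : ∀ a, (a, b) ∉ M') :
    P.netB M' M b = if ∃ a, (a, b) ∈ M then -1 else 0 := by
  simp [netB, prefB, h]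
  split_ifs <;> rfl

theorem neg_one_le_netA : -1 ≤ P.netA M' M a := by
  unfold netA
  split_ifs <;> simp

theorem neg_one_le_netB : -1 ≤ P.netB M' M b := by
  unfold netB
  split_ifs <;> simp

theorem netA_nonneg (h : ∀ b, (a, b) ∉ M) : 0 ≤ P.netA M' M a := by
  have : ¬ P.prefA M M' a := fun ⟨b, hb, _⟩ => h b hb
  simp only [netA, this, if_false]
  split_ifs <;> simp

theorem netB_nonneg (h : ∀ a, (a, b) ∉ M) : 0 ≤ P.netB M' M b := by
  have : ¬ P.prefB M M' b := fun ⟨a, ha, _⟩ => h a ha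
  simp only [netB, this, if_false]
  split_ifs <;> simp

/-- A dual certificate for the popularity of a matching. -/
structure IsWitness (P : PrefSys A B) (M : Finset (A × B)) (α : A → ℤ) (β : B → ℤ) : Prop where
  matched : ∀ a b, (a, b) ∈ M → α a + β b = 0
  freeA : ∀ a, (∀ b, (a, b) ∉ M) → α a = 0
  freeB : ∀ b, (∀ a, (a, b) ∉ M) → β b = 0
  boundA : ∀ a, -1 ≤ α a
  boundB : ∀ b, -1 ≤ β b
  edge : ∀ a b, P.adj a b → P.voteA M a b + P.voteB M a b ≤ α a + β b

theorem IsWitness.le_oneA {α : A → ℤ} {β : B → ℤ} (h : P.IsWitness M α β) (a : A) :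
    α a ≤ 1 := by
  by_cases ha : ∃ b, (a, b) ∈ M
  · obtain ⟨b, hb⟩ := ha
    linarith [h.matched a b hb, h.boundB b]
  · simp [h.freeA a (not_exists.1 ha)]

theorem IsWitness.le_oneB {α : A → ℤ} {β : B → ℤ} (h : P.IsWitness M α β) (b : B) :
    β b ≤ 1 := by
  by_cases hb : ∃ a, (a, b) ∈ M
  · obtain ⟨a, ha⟩ := hb
    linarith [h.matched a b ha, h.boundA a]
  · simp [h.freeB b (not_exists.1 hb)]

/-- The penalty for leaving the edge of `M` represented by a node unused. -/
def penalty {ι : Type} : Option ι → ℤ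
  | none => 0
  | some _ => -1

theorem sum_fiber_ge {X ι : Type} [Fintype X] [DecidableEq (Option ι)] (n : X → Option ι) (d : X → ℤ)
    (hd : ∀ x, -1 ≤ d x) (hn : ∀ i x y, n x = some i → n y = some i → x = y)
    (o : Option X) (u : Option ι) (ho : ∀ x, o = some x → n x = u)
    (h0 : ∀ x, n x = none → 0 ≤ d x) :
    o.elim (penalty u) d ≤ ∑ x with n x = u, d x := by
  cases u with
  | none =>
    have hnn : ∀ x ∈ Finset.univ.filter fun x => n x = none, 0 ≤ d x := fun x hx =>
      h0 x (by simpa using hx)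
    cases o with
    | none => simpa [penalty] using Finset.sum_nonneg hnn
    | some x => exact Finset.single_le_sum hnn (by simpa using ho x rfl)
  | some i =>
    by_cases hx : ∃ x, n x = some i
    · obtain ⟨x, hx⟩ := hx
      have hf : (Finset.univ.filter fun x => n x = some i) = {x} := by
        ext y
        simp only [Finset.mem_filter, Finset.mem_univ, true_and, Finset.mem_singleton]
        exact ⟨fun hy => hn i y x hy hx, fun hy => hy ▸ hx⟩
      rw [hf, Finset.sum_singleton]
      cases o with
      | none => simpa [penalty] using hd x
      | some y => simp [hn i y x (ho y rfl) hx]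
    · have hf : (Finset.univ.filter fun x => n x = some i) = ∅ := by
        ext y
        simpa using fun hy => hx ⟨y, hy⟩
      rw [hf, Finset.sum_empty]
      cases o with
      | none => simp [penalty]
      | some y => exact absurd ⟨y, ho y rfl⟩ hx

/-- The edge of `M` at a vertex, where `f` selects the side of the vertex. -/
noncomputable def mateEdge {X : Type} (f : A × B → X) (M : Finset (A × B)) (x : X) :
    Option {m // m ∈ M} :=
  if h : ∃ m : {m // m ∈ M}, f m = x then some h.choose else none

theorem mateEdge_some {X : Type} {f : A × B → X} {x : X} {m : {m // m ∈ M}}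
    (h : mateEdge f M x = some m) : f m = x := by
  unfold mateEdge at h
  split_ifs at h with hx
  cases h
  exact hx.choose_spec

theorem mateEdge_none {X : Type} {f : A × B → X} {x : X}
    (h : mateEdge f M x = none) : ∀ m ∈ M, f m ≠ x := by
  unfold mateEdge at h
  split_ifs at h with hx
  exact fun m hm hf => hx ⟨⟨m, hm⟩, hf⟩

theorem mateEdge_of_mem {X : Type} {f : A × B → X}
    (hf : ∀ p ∈ M, ∀ q ∈ M, f p = f q → p = q) {m : A × B} (hm : m ∈ M) :
    mateEdge f M (f m) = some ⟨m, hm⟩ := by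
  have hx : ∃ k : {m // m ∈ M}, f k = f m := ⟨⟨m, hm⟩, rfl⟩
  unfold mateEdge
  rw [dif_pos hx]
  exact congrArg some (Subtype.ext (hf _ hx.choose.2 _ hm hx.choose_spec))

/-- Popular matchings have dual certificates. -/
theorem Popular.exists_isWitness [Fintype A] [Fintype B] (hP : P.Popular M) :
    ∃ α β, P.IsWitness M α β := by
  have hM := hP.1
  set nA : A → Option {m // m ∈ M} := mateEdge Prod.fst M with hnA
  set nB : B → Option {m // m ∈ M} := mateEdge Prod.snd M with hnB
  let val : Option {m // m ∈ M} → Option {m // m ∈ M} → Option (A × B) → ℤ := fun u v o =>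
    o.elim (penalty u + penalty v) fun p => P.voteA M p.1 p.2 + P.voteB M p.1 p.2
  have hbest : ∀ u v, ∃ o : Option (A × B),
      (∀ p, o = some p → P.adj p.1 p.2 ∧ nA p.1 = u ∧ nB p.2 = v) ∧
      penalty u + penalty v ≤ val u v o ∧
      ∀ a b, P.adj a b → nA a = u → nB b = v → P.voteA M a b + P.voteB M a b ≤ val u v o := by
    intro u v
    obtain ⟨o, ho, hmax⟩ := Set.exists_max_image
      {o : Option (A × B) | ∀ p, o = some p → P.adj p.1 p.2 ∧ nA p.1 = u ∧ nB p.2 = v}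
      (val u v) (Set.toFinite _) ⟨none, by simp⟩
    refine ⟨o, ho, hmax none (by simp), fun a b hab ha hb => hmax (some (a, b)) ?_⟩
    rintro p ⟨⟩
    exact ⟨hab, ha, hb⟩
  choose c hc hc0 hcmax using hbest
  have hloop : ∀ v, 0 ≤ val v v (c v v) := by
    rintro (_ | ⟨⟨a, b⟩, hm⟩)
    · simpa [penalty] using hc0 none none
    · have := hcmax _ _ a b (hM.1 _ hm) (mateEdge_of_mem hM.2.1 hm) (mateEdge_of_mem hM.2.2 hm)
      simpa [voteA, voteB, hm] using this
  have hperm : ∀ σ : Equiv.Perm (Option {m // m ∈ M}), ∑ v, val v (σ v) (c v (σ v)) ≤ 0 := by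
    intro σ
    set N : Finset (A × B) :=
      Finset.univ.filter fun p => c (nA p.1) (σ (nA p.1)) = some p with hN
    have hmem : ∀ p, p ∈ N ↔ c (nA p.1) (σ (nA p.1)) = some p := by simp [hN]
    have hNM : P.IsMatching N := by
      refine ⟨fun p hp => (hc _ _ p ((hmem p).1 hp)).1, fun p hp q hq h => ?_,
        fun p hp q hq h => ?_⟩
      · have h1 := (hmem p).1 hp
        rw [h, (hmem q).1 hq] at h1
        exact (Option.some.inj h1).symm
      · have h1 := (hc _ _ p ((hmem p).1 hp)).2.2
        have h2 := (hc _ _ q ((hmem q).1 hq)).2.2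
        have h3 : nA p.1 = nA q.1 := σ.injective (by rw [← h1, ← h2, h])
        have h4 := (hmem p).1 hp
        rw [h3, (hmem q).1 hq] at h4
        exact (Option.some.inj h4).symm
    have hle := hP.2 N hNM
    have hphi := P.phi_sub_phi M N
    have hcN : ∀ u p, c u (σ u) = some p → p ∈ N := fun u p h => by
      rw [hmem, (hc _ _ p h).2.1, h]
    have hA : ∀ u, ((c u (σ u)).map Prod.fst).elim (penalty u) (P.netA N M) ≤
        ∑ a with nA a = u, P.netA N M a := by
      intro u
      refine sum_fiber_ge nA _ (fun _ => neg_one_le_netA) (fun i x y hx hy => ?_) _ _ ?_ ?_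
      · exact (mateEdge_some hx).symm.trans (mateEdge_some hy)
      · intro x hx
        obtain ⟨p, hp, rfl⟩ := Option.map_eq_some_iff.1 hx
        exact (hc _ _ p hp).2.1
      · exact fun x hx => netA_nonneg fun b hb => mateEdge_none hx _ hb rfl
    have hB : ∀ u, ((c u (σ u)).map Prod.snd).elim (penalty (σ u)) (P.netB N M) ≤
        ∑ b with nB b = σ u, P.netB N M b := by
      intro u
      refine sum_fiber_ge nB _ (fun _ => neg_one_le_netB) (fun i x y hx hy => ?_) _ _ ?_ ?_
      · exact (mateEdge_some hx).symm.trans (mateEdge_some hy)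
      · intro x hx
        obtain ⟨p, hp, rfl⟩ := Option.map_eq_some_iff.1 hx
        exact (hc _ _ p hp).2.2
      · exact fun x hx => netB_nonneg fun a ha => mateEdge_none hx _ ha rfl
    have hval : ∀ u, val u (σ u) (c u (σ u)) ≤
        ∑ a with nA a = u, P.netA N M a + ∑ b with nB b = σ u, P.netB N M b := by
      intro u
      have h1 := hA u
      have h2 := hB u
      cases ho : c u (σ u) with
      | none =>
        rw [ho] at h1 h2
        exact add_le_add h1 h2
      | some p =>
        rw [ho] at h1 h2
        simp only [Option.map_some, Option.elim_some, netA_of_mem hM hNM (hcN u p ho),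
          netB_of_mem hM hNM (hcN u p ho)] at h1 h2
        exact add_le_add h1 h2
    have hsum := Finset.sum_le_sum fun u (_ : u ∈ Finset.univ) => hval u
    rw [Finset.sum_add_distrib, Finset.sum_fiberwise,
      Equiv.sum_comp σ fun v => ∑ b with nB b = v, P.netB N M b, Finset.sum_fiberwise] at hsum
    have hle' : (P.phi N M : ℤ) ≤ P.phi M N := by exact_mod_cast hle
    linarith
  obtain ⟨q, hq⟩ := exists_potential (fun u v => val u v (c u v)) hloop hperm
  have hq0 : ∀ u v, penalty u + penalty v + q v ≤ q u := fun u v =>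
    (add_le_add_left (hc0 u v) (q v)).trans (hq u v)
  refine ⟨fun a => q (nA a) - q none, fun b => q none - q (nB b), ?_, ?_, ?_, ?_, ?_, ?_⟩
  · intro a b hab
    have h1 : nA a = _ := mateEdge_of_mem hM.2.1 hab
    have h2 : nB b = _ := mateEdge_of_mem hM.2.2 hab
    simp [h1, h2]
  · intro a ha
    have : nA a = none := by
      cases h : nA a with
      | none => rfl
      | some m => exact (ha m.1.2 (by rw [← mateEdge_some h]; exact m.2)).elim
    simp [this]
  · intro b hb
    have : nB b = none := by
      cases h : nB b with
      | none => rfl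
      | some m => exact (hb m.1.1 (by rw [← mateEdge_some h]; exact m.2)).elim
    simp [this]
  · intro a
    have h1 := hq0 (nA a) none
    cases hn : nA a <;> simp only [hn, penalty, sub_self] at h1 ⊢ <;> linarith
  · intro b
    have h1 := hq0 none (nB b)
    cases hn : nB b <;> simp only [hn, penalty, sub_self] at h1 ⊢ <;> linarith
  · intro a b hab
    have h1 : val (nA a) (nB b) (c (nA a) (nB b)) + q (nB b) ≤ q (nA a) := hq _ _
    have h2 := hcmax _ _ a b hab rfl rfl
    linarith

theorem sum_le_sum_image {X : Type} [Fintype X] (f : A × B → X) (N : Finset (A × B))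
    (hf : ∀ p ∈ N, ∀ q ∈ N, f p = f q → p = q) (d : X → ℤ)
    (hd : ∀ x, (∀ p ∈ N, f p ≠ x) → d x ≤ 0) : ∑ x, d x ≤ ∑ p ∈ N, d (f p) := by
  rw [← Finset.sum_image (f := d) hf, ← Finset.sum_add_sum_compl (N.image f) d]
  have : ∑ x ∈ (N.image f)ᶜ, d x ≤ 0 := Finset.sum_nonpos fun x hx => hd x fun p hp h =>
    (Finset.mem_compl.1 hx) (Finset.mem_image.2 ⟨p, hp, h⟩)
  linarith

/-- The margin of an election against a matching with a dual certificate. -/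
theorem IsWitness.phi_sub_phi_le [Fintype A] [Fintype B] {α : A → ℤ} {β : B → ℤ}
    (hW : P.IsWitness M α β) (hM : P.IsMatching M) (hM' : P.IsMatching M') :
    (P.phi M' M : ℤ) - P.phi M M' ≤
      ∑ p ∈ M', (P.voteA M p.1 p.2 + P.voteB M p.1 p.2 - (α p.1 + β p.2)) := by
  have hA : ∑ a, (P.netA M' M a - α a) ≤ ∑ p ∈ M', (P.netA M' M p.1 - α p.1) := by
    refine sum_le_sum_image Prod.fst M' hM'.2.1 (fun a => P.netA M' M a - α a) fun a ha => ?_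
    rw [netA_of_free fun b hb => ha _ hb rfl]
    split_ifs with h
    · linarith [hW.boundA a]
    · simp [hW.freeA a (not_exists.1 h)]
  have hB : ∑ b, (P.netB M' M b - β b) ≤ ∑ p ∈ M', (P.netB M' M p.2 - β p.2) := by
    refine sum_le_sum_image Prod.snd M' hM'.2.2 (fun b => P.netB M' M b - β b) fun b hb => ?_
    rw [netB_of_free fun a ha => hb _ ha rfl]
    split_ifs with h
    · linarith [hW.boundB b]
    · simp [hW.freeB b (not_exists.1 h)]
  have hα : ∑ a, α a ≤ ∑ p ∈ M, α p.1 := sum_le_sum_image Prod.fst M hM.2.1 α fun a ha =>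
    (hW.freeA a fun b hb => ha _ hb rfl).le
  have hβ : ∑ b, β b ≤ ∑ p ∈ M, β p.2 := sum_le_sum_image Prod.snd M hM.2.2 β fun b hb =>
    (hW.freeB b fun a ha => hb _ ha rfl).le
  have h0 : ∑ p ∈ M, α p.1 + ∑ p ∈ M, β p.2 = 0 := by
    rw [← Finset.sum_add_distrib]
    exact Finset.sum_eq_zero fun p hp => hW.matched _ _ hp
  have h1 : ∑ p ∈ M', (P.voteA M p.1 p.2 + P.voteB M p.1 p.2 - (α p.1 + β p.2)) =
      ∑ p ∈ M', (P.netA M' M p.1 - α p.1) + ∑ p ∈ M', (P.netB M' M p.2 - β p.2) := by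
    rw [← Finset.sum_add_distrib]
    refine Finset.sum_congr rfl fun p hp => ?_
    rw [netA_of_mem hM hM' hp, netB_of_mem hM hM' hp]
    ring
  rw [phi_sub_phi, h1]
  simp only [Finset.sum_sub_distrib] at hA hB ⊢
  linarith

/-- A dual certificate that vanishes at no matched vertex proves dominance. -/
theorem IsWitness.dominant [Fintype A] [Fintype B] {α : A → ℤ} {β : B → ℤ}
    (hW : P.IsWitness M α β) (hM : P.IsMatching M) (hne : ∀ a b, (a, b) ∈ M → α a ≠ 0) :
    P.Dominant M := by
  refine ⟨⟨hM, fun M' hM' => ?_⟩, fun M' hM' hcard => ?_⟩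
  · have h1 := hW.phi_sub_phi_le hM hM'
    have h2 : ∑ p ∈ M', (P.voteA M p.1 p.2 + P.voteB M p.1 p.2 - (α p.1 + β p.2)) ≤ 0 :=
      Finset.sum_nonpos fun p hp => sub_nonpos.2 (hW.edge _ _ (hM'.1 p hp))
    omega
  · have h1 := hW.phi_sub_phi_le hM hM'
    obtain ⟨⟨a, b⟩, hp, hfree⟩ : ∃ p ∈ M', ∀ q ∈ M, q.1 ≠ p.1 := by
      by_contra! hcon
      have hsub : M'.image Prod.fst ⊆ M.image Prod.fst := fun a ha => by
        obtain ⟨p, hp, rfl⟩ := Finset.mem_image.1 ha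
        obtain ⟨q, hq, hqp⟩ := hcon p hp
        exact Finset.mem_image.2 ⟨q, hq, hqp⟩
      have h2 := Finset.card_le_card hsub
      rw [Finset.card_image_of_injOn hM'.2.1, Finset.card_image_of_injOn hM.2.1] at h2
      omega
    have ha : ∀ b', (a, b') ∉ M := fun b' h => hfree _ h rfl
    have hlt : P.voteA M a b + P.voteB M a b - (α a + β b) < 0 := by
      have hedge := hW.edge a b (hM'.1 _ hp)
      have hα := hW.freeA a ha
      have hvA : P.voteA M a b = 1 := by
        simp [voteA, ha, voteAplus]
      have hvB : P.voteB M a b = 1 ∨ P.voteB M a b = -1 := by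
        simp only [voteB, ha, if_false]
        split_ifs <;> simp
      by_cases hb : ∃ a', (a', b) ∈ M
      · obtain ⟨a', ha'⟩ := hb
        have h3 := hW.matched _ _ ha'
        have h4 := hne _ _ ha'
        have h5 := hW.boundA a'
        have h6 := hW.le_oneA a'
        omega
      · have h3 := hW.freeB b (not_exists.1 hb)
        have h4 : P.voteB M a b = 1 := by
          have h5 : ∀ a', (a', b) ∉ M := not_exists.1 hb
          simp [voteB, voteBplus, h5]
        omega
    have h2 : ∑ p ∈ M', (P.voteA M p.1 p.2 + P.voteB M p.1 p.2 - (α p.1 + β p.2)) < 0 :=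
      Finset.sum_neg' (fun p hp => sub_nonpos.2 (hW.edge _ _ (hM'.1 p hp))) ⟨_, hp, hlt⟩
    omega

/-- `a` finds `b` at least as good as its `M`-partner. -/
def weakA (P : PrefSys A B) (M : Finset (A × B)) (a : A) (b : B) : Prop :=
  ∀ c, (a, c) ∈ M → P.rankA a b ≤ P.rankA a c

/-- `b` finds `a` at least as good as its `M`-partner. -/
def weakB (P : PrefSys A B) (M : Finset (A × B)) (a : A) (b : B) : Prop :=
  ∀ a', (a', b) ∈ M → P.rankB b a ≤ P.rankB b a'

theorem IsMatching.weakA_of_mem (hM : P.IsMatching M) (h : (a, b) ∈ M) : P.weakA M a b :=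
  fun _ h' => by rw [hM.right_unique h h']

theorem IsMatching.weakB_of_mem (hM : P.IsMatching M) (h : (a, b) ∈ M) : P.weakB M a b :=
  fun _ h' => by rw [hM.left_unique h h']

theorem voteA_of_weakA (hM : P.IsMatching M) (hab : P.adj a b) (h : (a, b) ∉ M)
    (hw : P.weakA M a b) : P.voteA M a b = 1 := by
  have : P.voteAplus M a b := fun b' hb' => lt_of_le_of_ne (hw b' hb') fun heq =>
    h (by rwa [P.rankA_inj a b b' hab (hM.1 _ hb') heq])
  simp [voteA, h, this]

theorem voteB_of_weakB (hM : P.IsMatching M) (hab : P.adj a b) (h : (a, b) ∉ M)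
    (hw : P.weakB M a b) : P.voteB M a b = 1 := by
  have : P.voteBplus M a b := fun a' ha' => lt_of_le_of_ne (hw a' ha') fun heq =>
    h (by rwa [P.rankB_inj b a a' hab (hM.1 _ ha') heq])
  simp [voteB, h, this]

theorem voteA_of_lt (hM : P.IsMatching M) (h : (a, b) ∈ M) (hlt : P.rankA a b' < P.rankA a b) :
    (a, b') ∉ M ∧ P.voteA M a b' = 1 := by
  have h1 : (a, b') ∉ M := fun h' => by simp [hM.right_unique h h'] at hlt
  have h2 : P.voteAplus M a b' := fun c hc => hM.right_unique h hc ▸ hlt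
  exact ⟨h1, by simp [voteA, h1, h2]⟩

theorem voteB_of_lt (hM : P.IsMatching M) (h : (a, b) ∈ M) (hlt : P.rankB b a' < P.rankB b a) :
    (a', b) ∉ M ∧ P.voteB M a' b = 1 := by
  have h1 : (a', b) ∉ M := fun h' => by simp [hM.left_unique h h'] at hlt
  have h2 : P.voteBplus M a' b := fun c hc => hM.left_unique h hc ▸ hlt
  exact ⟨h1, by simp [voteB, h1, h2]⟩

theorem voteA_eq_or (h : (a, b) ∉ M) : P.voteA M a b = 1 ∨ P.voteA M a b = -1 := by
  simp only [voteA, h, if_false]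
  split_ifs <;> simp

theorem voteB_eq_or (h : (a, b) ∉ M) : P.voteB M a b = 1 ∨ P.voteB M a b = -1 := by
  simp only [voteB, h, if_false]
  split_ifs <;> simp

theorem voteA_eq_one_iff (h : (a, b) ∉ M) : P.voteA M a b = 1 ↔ P.voteAplus M a b := by
  simp [voteA, h]

theorem voteB_eq_one_iff (h : (a, b) ∉ M) : P.voteB M a b = 1 ↔ P.voteBplus M a b := by
  simp [voteB, h]

/-- The edges of a matching on which the certificate vanishes extend to a stable matching. -/
theorem IsWitness.exists_stable [Fintype A] [Fintype B] {α : A → ℤ} {β : B → ℤ}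
    (hW : P.IsWitness M α β) (hM : P.IsMatching M) :
    ∃ S, P.Stable S ∧ ∀ a b, (a, b) ∈ M → α a = 0 → (a, b) ∈ S := by
  set C : Finset (A × B) := Finset.univ.filter fun p => P.adj p.1 p.2 ∧
    (0 ≤ α p.1 → P.weakA M p.1 p.2) ∧ (0 ≤ β p.2 → P.weakB M p.1 p.2) with hC
  have hmem : ∀ a b, (a, b) ∈ C ↔ P.adj a b ∧ (0 ≤ α a → P.weakA M a b) ∧
      (0 ≤ β b → P.weakB M a b) := by simp [hC]
  have hMC : ∀ a b, (a, b) ∈ M → (a, b) ∈ C := fun a b h => (hmem a b).2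
    ⟨hM.1 _ h, fun _ => hM.weakA_of_mem h, fun _ => hM.weakB_of_mem h⟩
  have hCM : ∀ a b, (a, b) ∈ C → (a, b) ∉ M → α a ≠ 0 ∧ β b ≠ 0 ∧
      (0 ≤ α a → P.voteA M a b = 1) ∧ (0 ≤ β b → P.voteB M a b = 1) ∧
      P.voteA M a b + P.voteB M a b ≤ α a + β b := by
    intro a b h hn
    obtain ⟨hab, hwA, hwB⟩ := (hmem a b).1 h
    have hA := fun h0 => voteA_of_weakA hM hab hn (hwA h0)
    have hB := fun h0 => voteB_of_weakB hM hab hn (hwB h0)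
    have hedge := hW.edge a b hab
    have := voteA_eq_or (P := P) hn
    have := voteB_eq_or (P := P) hn
    have := hW.boundA a
    have := hW.boundB b
    have := hW.le_oneA a
    have := hW.le_oneB b
    refine ⟨?_, ?_, hA, hB, hedge⟩ <;> omega
  obtain ⟨S, hSC, hSf, hSg, hS⟩ := exists_stable_contracts (R := ℕ) Prod.fst Prod.snd
    (fun p : A × B => P.rankA p.1 p.2) (fun p => P.rankB p.2 p.1) C
    (by
      rintro ⟨a, b⟩ hx ⟨a', b'⟩ hy h hr
      obtain rfl : a = a' := h
      rw [P.rankA_inj a b b' ((hmem _ _).1 hx).1 ((hmem _ _).1 hy).1 hr])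
    (by
      rintro ⟨a, b⟩ hx ⟨a', b'⟩ hy h hr
      obtain rfl : b = b' := h
      rw [P.rankB_inj b a a' ((hmem _ _).1 hx).1 ((hmem _ _).1 hy).1 hr])
  have hzero : ∀ a b, (a, b) ∈ M → α a = 0 → (a, b) ∈ S := by
    intro a b h h0
    by_contra hn
    rcases hS (a, b) (hMC a b h) hn with ⟨⟨a', b'⟩, hy, heq, hlt⟩ | ⟨⟨a', b'⟩, hy, heq, hlt⟩
    · obtain rfl : a' = a := heq
      exact (hCM _ _ (hSC hy) (voteA_of_lt hM h hlt).1).1 h0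
    · obtain rfl : b' = b := heq
      have := hW.matched _ _ h
      exact (hCM _ _ (hSC hy) (voteB_of_lt hM h hlt).1).2.1 (by omega)
  have himpA : ∀ a b, (a, b) ∈ M → 0 ≤ α a → ∃ b', (a, b') ∈ S ∧ P.rankA a b' ≤ P.rankA a b := by
    intro a b h h0
    by_cases hn : (a, b) ∈ S
    · exact ⟨b, hn, le_rfl⟩
    rcases hS (a, b) (hMC a b h) hn with ⟨⟨a', b'⟩, hy, heq, hlt⟩ | ⟨⟨a', b'⟩, hy, heq, hlt⟩
    · obtain rfl : a' = a := heq
      exact ⟨b', hy, hlt.le⟩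
    · obtain rfl : b' = b := heq
      obtain ⟨hn', hv⟩ : (a', b') ∉ M ∧ P.voteB M a' b' = 1 := voteB_of_lt hM h hlt
      have h1 := hCM _ _ (hSC hy) hn'
      have h2 := hW.matched _ _ h
      have := hW.boundA a'
      have := hW.le_oneA a'
      have := hW.le_oneA a
      have := voteA_eq_or (P := P) hn'
      omega
  have himpB : ∀ a b, (a, b) ∈ M → 0 ≤ β b → ∃ a', (a', b) ∈ S ∧ P.rankB b a' ≤ P.rankB b a := by
    intro a b h h0
    by_cases hn : (a, b) ∈ S
    · exact ⟨a, hn, le_rfl⟩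
    rcases hS (a, b) (hMC a b h) hn with ⟨⟨a', b'⟩, hy, heq, hlt⟩ | ⟨⟨a', b'⟩, hy, heq, hlt⟩
    · obtain rfl : a' = a := heq
      obtain ⟨hn', hv⟩ : (a', b') ∉ M ∧ P.voteA M a' b' = 1 := voteA_of_lt hM h hlt
      have h1 := hCM _ _ (hSC hy) hn'
      have h2 := hW.matched _ _ h
      have := hW.boundB b'
      have := hW.le_oneB b'
      have := hW.le_oneB b
      have := voteB_eq_or (P := P) hn'
      omega
    · obtain rfl : b' = b := heq
      exact ⟨a', hy, hlt.le⟩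
  refine ⟨S, ⟨⟨fun p hp => ((hmem p.1 p.2).1 (hSC hp)).1, hSf, hSg⟩, ?_⟩, hzero⟩
  rintro a b ⟨hab, hn, hvA, hvB⟩
  by_cases habC : (a, b) ∈ C
  · rcases hS (a, b) habC hn with ⟨⟨a', b'⟩, hy, heq, hlt⟩ | ⟨⟨a', b'⟩, hy, heq, hlt⟩
    · obtain rfl : a' = a := heq
      exact lt_asymm (hvA b' hy) hlt
    · obtain rfl : b' = b := heq
      exact lt_asymm (hvB a' hy) hlt
  · rw [hmem] at habC
    refine habC ⟨hab, fun h0 b' hb' => ?_, fun h0 a' ha' => ?_⟩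
    · obtain ⟨c, hc, hle⟩ := himpA a b' hb' h0
      exact ((hvA c hc).trans_le hle).le
    · obtain ⟨c, hc, hle⟩ := himpB a' b ha' h0
      exact ((hvB c hc).trans_le hle).le

/-- The sign given to a vertex by a set of signed contracts. -/
noncomputable def contractSign {X Y : Type} (S : Finset X) (f : X → Y) (sgn : X → ℤ) (y : Y) : ℤ :=
  if h : ∃ x ∈ S, f x = y then sgn h.choose else 0

theorem contractSign_of_mem {X Y : Type} {S : Finset X} {f : X → Y} {sgn : X → ℤ} {x : X}
    (hf : ∀ x ∈ S, ∀ y ∈ S, f x = f y → x = y) (hx : x ∈ S) :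
    contractSign S f sgn (f x) = sgn x := by
  have h : ∃ y ∈ S, f y = f x := ⟨x, hx, rfl⟩
  unfold contractSign
  rw [dif_pos h, hf _ h.choose_spec.1 x hx h.choose_spec.2]

theorem contractSign_of_free {X Y : Type} {S : Finset X} {f : X → Y} {sgn : X → ℤ} {y : Y}
    (h : ∀ x ∈ S, f x ≠ y) : contractSign S f sgn y = 0 :=
  dif_neg fun ⟨x, hx, hxy⟩ => h x hx hxy

/-- Existence of stable sets of contracts when every edge comes in two versions: the side `A`
prefers every version `true` to every version `false`, and the side `B` the other way around. -/
theorem exists_stable_signed_contracts (P : PrefSys A B) (C : Finset (A × B × Bool))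
    (hC : ∀ x ∈ C, P.adj x.1 x.2.1) :
    ∃ S ⊆ C, (∀ x ∈ S, ∀ y ∈ S, x.1 = y.1 → x = y) ∧
      (∀ x ∈ S, ∀ y ∈ S, x.2.1 = y.2.1 → x = y) ∧
      ∀ a b t, (a, b, t) ∈ C → (a, b, t) ∉ S →
        (∃ b' t', (a, b', t') ∈ S ∧
          (t' = true ∧ t = false ∨ t' = t ∧ P.rankA a b' < P.rankA a b)) ∨
        (∃ a' t', (a', b, t') ∈ S ∧
          (t' = false ∧ t = true ∨ t' = t ∧ P.rankB b a' < P.rankB b a)) := by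
  obtain ⟨S, hSC, hSf, hSg, hS⟩ := exists_stable_contracts (R := ℕ ×ₗ ℕ) (fun x => x.1)
    (fun x => x.2.1) (fun x : A × B × Bool => toLex (if x.2.2 then 0 else 1, P.rankA x.1 x.2.1))
    (fun x => toLex (if x.2.2 then 1 else 0, P.rankB x.2.1 x.1)) C
    (by
      rintro ⟨a, b, t⟩ hx ⟨a', b', t'⟩ hy h hr
      obtain rfl : a = a' := h
      have hr' := Prod.mk.inj (toLex_inj.1 hr)
      rw [P.rankA_inj a b b' (hC _ hx) (hC _ hy) hr'.2]
      cases t <;> cases t' <;> first | rfl | exact absurd hr'.1 (by simp))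
    (by
      rintro ⟨a, b, t⟩ hx ⟨a', b', t'⟩ hy h hr
      obtain rfl : b = b' := h
      have hr' := Prod.mk.inj (toLex_inj.1 hr)
      rw [P.rankB_inj b a a' (hC _ hx) (hC _ hy) hr'.2]
      cases t <;> cases t' <;> first | rfl | exact absurd hr'.1 (by simp))
  refine ⟨S, hSC, hSf, hSg, fun a b t hx hn => ?_⟩
  rcases hS _ hx hn with ⟨⟨a', b', t'⟩, hy, heq, hlt⟩ | ⟨⟨a', b', t'⟩, hy, heq, hlt⟩
  · left
    obtain rfl : a' = a := heq
    refine ⟨b', t', hy, ?_⟩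
    rw [Prod.Lex.toLex_lt_toLex] at hlt
    cases t <;> cases t' <;> simpa using hlt
  · right
    obtain rfl : b' = b := heq
    refine ⟨a', t', hy, ?_⟩
    rw [Prod.Lex.toLex_lt_toLex] at hlt
    cases t <;> cases t' <;> simpa using hlt

/-- The edges of a matching on which the certificate does not vanish extend to a dominant
matching. -/
theorem IsWitness.exists_dominant [Fintype A] [Fintype B] {α : A → ℤ} {β : B → ℤ}
    (hW : P.IsWitness M α β) (hM : P.IsMatching M) :
    ∃ D, P.Dominant D ∧ ∀ a b, (a, b) ∈ M → α a ≠ 0 → (a, b) ∈ D := by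
  set C : Finset (A × B × Bool) := Finset.univ.filter fun x => P.adj x.1 x.2.1 ∧
    ((α x.1 = 0 ∧ β x.2.1 = 0 ∧ (x.2.2 = true → P.weakB M x.1 x.2.1) ∧
      (x.2.2 = false → P.weakA M x.1 x.2.1)) ∨
    ((x.1, x.2.1) ∈ M ∧ α x.1 = if x.2.2 then 1 else -1)) with hC
  have hmem : ∀ a b t, (a, b, t) ∈ C ↔ P.adj a b ∧
    ((α a = 0 ∧ β b = 0 ∧ (t = true → P.weakB M a b) ∧ (t = false → P.weakA M a b)) ∨
    ((a, b) ∈ M ∧ α a = if t then 1 else -1)) := by simp [hC]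
  obtain ⟨S, hSC, hSf, hSg, hstab⟩ := P.exists_stable_signed_contracts C fun x hx =>
    ((hmem x.1 x.2.1 x.2.2).1 hx).1
  set γ : A → ℤ := contractSign S (fun x => x.1) fun x => if x.2.2 then 1 else -1 with hγ
  set δ : B → ℤ := contractSign S (fun x => x.2.1) fun x => if x.2.2 then -1 else 1 with hδ
  have hγS : ∀ a b t, (a, b, t) ∈ S → γ a = if t then 1 else -1 := fun a b t h =>
    contractSign_of_mem (f := fun x : A × B × Bool => x.1) hSf h
  have hδS : ∀ a b t, (a, b, t) ∈ S → δ b = if t then -1 else 1 := fun a b t h =>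
    contractSign_of_mem (f := fun x : A × B × Bool => x.2.1) hSg h
  have hγ0 : ∀ a, (∀ b t, (a, b, t) ∉ S) → γ a = 0 := fun a h =>
    contractSign_of_free fun x hx hxa => h x.2.1 x.2.2 (hxa ▸ hx)
  have hδ0 : ∀ b, (∀ a t, (a, b, t) ∉ S) → δ b = 0 := fun b h =>
    contractSign_of_free fun x hx hxb => h x.1 x.2.2 (hxb ▸ hx)
  -- contracts on edges of `M` where the certificate does not vanish are kept
  have hkeep : ∀ a b, (a, b) ∈ M → α a ≠ 0 → ∃ t, (a, b, t) ∈ S ∧ α a = if t then 1 else -1 := by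
    intro a b h h0
    have hb := hW.matched _ _ h
    have h1 := hW.boundA a
    have h2 := hW.le_oneA a
    obtain ⟨t, ht⟩ : ∃ t : Bool, α a = if t then 1 else -1 := by
      rcases (by omega : α a = 1 ∨ α a = -1) with h | h
      · exact ⟨true, by simpa using h⟩
      · exact ⟨false, by simpa using h⟩
    have hxC : (a, b, t) ∈ C := (hmem _ _ _).2 ⟨hM.1 _ h, Or.inr ⟨h, ht⟩⟩
    refine ⟨t, ?_, ht⟩
    by_contra hn
    rcases hstab a b t hxC hn with ⟨b', t', hy, hlt⟩ | ⟨a', t', hy, hlt⟩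
    · rcases ((hmem _ _ _).1 (hSC hy)).2 with ⟨h3, -⟩ | ⟨h3, h4⟩
      · exact h0 h3
      · obtain rfl := hM.right_unique h h3
        obtain rfl : t = t' := by
          rw [ht] at h4
          cases t <;> cases t' <;> simp at h4 ⊢
        exact hn hy
    · rcases ((hmem _ _ _).1 (hSC hy)).2 with ⟨-, h3, -⟩ | ⟨h3, h4⟩
      · omega
      · obtain rfl := hM.left_unique h h3
        obtain rfl : t = t' := by
          rw [ht] at h4
          cases t <;> cases t' <;> simp at h4 ⊢
        exact hn hy
  -- contracts away from those edges
  have hzero : ∀ a b t, (a, b, t) ∈ S → α a = 0 ∨ β b = 0 → P.adj a b ∧ α a = 0 ∧ β b = 0 ∧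
      (t = true → P.weakB M a b) ∧ (t = false → P.weakA M a b) := by
    intro a b t hx h0
    obtain ⟨hab, h1 | ⟨h1, h2⟩⟩ := (hmem _ _ _).1 (hSC hx)
    · exact ⟨hab, h1⟩
    · have := hW.matched _ _ h1
      cases t <;> simp at h2 <;> omega
  have hcovA : ∀ a b, (a, b) ∈ M → ∃ b' t, (a, b', t) ∈ S := by
    intro a b h
    by_cases h0 : α a = 0
    · have hb := hW.matched _ _ h
      have hxC : (a, b, false) ∈ C := (hmem _ _ _).2 ⟨hM.1 _ h,
        Or.inl ⟨h0, by omega, by simp, fun _ => hM.weakA_of_mem h⟩⟩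
      by_cases hn : (a, b, false) ∈ S
      · exact ⟨b, _, hn⟩
      rcases hstab _ _ _ hxC hn with ⟨b', t', hy, -⟩ | ⟨a', t', hy, hlt⟩
      · exact ⟨b', t', hy⟩
      · obtain ⟨rfl, hlt'⟩ : t' = false ∧ P.rankB b a' < P.rankB b a := by simpa using hlt
        obtain ⟨hab, h1, h2, -, h3⟩ := hzero _ _ _ hy (Or.inr (by omega))
        obtain ⟨hn', hv⟩ := voteB_of_lt hM h hlt'
        have := voteA_of_weakA hM hab hn' (h3 rfl)
        have := hW.edge _ _ hab
        omega
    · obtain ⟨t, ht, -⟩ := hkeep a b h h0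
      exact ⟨b, t, ht⟩
  have hcovB : ∀ a b, (a, b) ∈ M → ∃ a' t, (a', b, t) ∈ S := by
    intro a b h
    by_cases h0 : α a = 0
    · have hb := hW.matched _ _ h
      have hxC : (a, b, true) ∈ C := (hmem _ _ _).2 ⟨hM.1 _ h,
        Or.inl ⟨h0, by omega, fun _ => hM.weakB_of_mem h, by simp⟩⟩
      by_cases hn : (a, b, true) ∈ S
      · exact ⟨a, _, hn⟩
      rcases hstab _ _ _ hxC hn with ⟨b', t', hy, hlt⟩ | ⟨a', t', hy, -⟩
      · obtain ⟨rfl, hlt'⟩ : t' = true ∧ P.rankA a b' < P.rankA a b := by simpa using hlt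
        obtain ⟨hab, h1, h2, h3, -⟩ := hzero _ _ _ hy (Or.inl h0)
        obtain ⟨hn', hv⟩ := voteA_of_lt hM h hlt'
        have := voteB_of_weakB hM hab hn' (h3 rfl)
        have := hW.edge _ _ hab
        omega
      · exact ⟨a', t', hy⟩
    · obtain ⟨t, ht, -⟩ := hkeep a b h h0
      exact ⟨a, t, ht⟩
  set D : Finset (A × B) := S.image fun x => (x.1, x.2.1) with hD
  have hmemD : ∀ a b, (a, b) ∈ D ↔ ∃ t, (a, b, t) ∈ S := by simp [hD]
  have hDM : P.IsMatching D := by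
    refine ⟨?_, ?_, ?_⟩
    · rintro ⟨a, b⟩ hp
      obtain ⟨t, ht⟩ := (hmemD a b).1 hp
      exact ((hmem _ _ _).1 (hSC ht)).1
    · rintro ⟨a, b⟩ hp ⟨a', b'⟩ hq h
      obtain ⟨t, ht⟩ := (hmemD a b).1 hp
      obtain ⟨t', ht'⟩ := (hmemD a' b').1 hq
      cases hSf _ ht _ ht' h
      rfl
    · rintro ⟨a, b⟩ hp ⟨a', b'⟩ hq h
      obtain ⟨t, ht⟩ := (hmemD a b).1 hp
      obtain ⟨t', ht'⟩ := (hmemD a' b').1 hq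
      cases hSg _ ht _ ht' h
      rfl
  have hsignA : ∀ a, (γ a = 0 ∧ ∀ b t, (a, b, t) ∉ S) ∨
      ∃ b t, (a, b, t) ∈ S ∧ γ a = if t then 1 else -1 := by
    intro a
    by_cases h : ∃ b t, (a, b, t) ∈ S
    · obtain ⟨b, t, h⟩ := h
      exact Or.inr ⟨b, t, h, hγS a b t h⟩
    · push Not at h
      exact Or.inl ⟨hγ0 a h, h⟩
  have hsignB : ∀ b, (δ b = 0 ∧ ∀ a t, (a, b, t) ∉ S) ∨
      ∃ a t, (a, b, t) ∈ S ∧ δ b = if t then -1 else 1 := by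
    intro b
    by_cases h : ∃ a t, (a, b, t) ∈ S
    · obtain ⟨a, t, h⟩ := h
      exact Or.inr ⟨a, t, h, hδS a b t h⟩
    · push Not at h
      exact Or.inl ⟨hδ0 b h, h⟩
  have hγ3 : ∀ a, γ a = 0 ∨ γ a = 1 ∨ γ a = -1 := fun a => by
    rcases hsignA a with ⟨h, -⟩ | ⟨b, t, -, h⟩
    · exact Or.inl h
    · cases t <;> simp [h]
  have hδ3 : ∀ b, δ b = 0 ∨ δ b = 1 ∨ δ b = -1 := fun b => by
    rcases hsignB b with ⟨h, -⟩ | ⟨a, t, -, h⟩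
    · exact Or.inl h
    · cases t <;> simp [h]
  -- off the support of the old certificate, vertices with nonpositive sign have not lost
  have hplusA : ∀ a b, α a = 0 → γ a ≤ 0 → P.voteAplus D a b → P.voteAplus M a b := by
    intro a b h0 hs hv b' hb'
    obtain ⟨c, t, hc⟩ := hcovA a b' hb'
    have hs' := hγS _ _ _ hc
    obtain rfl : t = false := by
      cases t
      · rfl
      · simp at hs'; omega
    exact (hv c ((hmemD _ _).2 ⟨_, hc⟩)).trans_le
      ((hzero _ _ _ hc (Or.inl h0)).2.2.2.2 rfl b' hb')
  have hplusB : ∀ a b, β b = 0 → δ b ≤ 0 → P.voteBplus D a b → P.voteBplus M a b := by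
    intro a b h0 hs hv a' ha'
    obtain ⟨c, t, hc⟩ := hcovB a' b ha'
    have hs' := hδS _ _ _ hc
    obtain rfl : t = true := by
      cases t
      · simp at hs'; omega
      · rfl
    exact (hv c ((hmemD _ _).2 ⟨_, hc⟩)).trans_le
      ((hzero _ _ _ hc (Or.inr h0)).2.2.2.1 rfl a' ha')
  have hsameA : ∀ a b, α a ≠ 0 → γ a = α a ∧ P.voteA D a b = P.voteA M a b := by
    intro a b h0
    obtain ⟨c, hc⟩ : ∃ c, (a, c) ∈ M := by
      by_contra h
      exact h0 (hW.freeA a (not_exists.1 h))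
    obtain ⟨t, ht, hα⟩ := hkeep a c hc h0
    have hcD : (a, c) ∈ D := (hmemD _ _).2 ⟨t, ht⟩
    have hiff : ∀ d, (a, d) ∈ D ↔ (a, d) ∈ M := fun d =>
      ⟨fun h => hDM.right_unique hcD h ▸ hc, fun h => hM.right_unique hc h ▸ hcD⟩
    exact ⟨(hγS _ _ _ ht).trans hα.symm, if_congr (hiff b) rfl (if_congr (by simp [voteAplus, hiff]) rfl rfl)⟩
  have hsameB : ∀ a b, β b ≠ 0 → δ b = β b ∧ P.voteB D a b = P.voteB M a b := by
    intro a b h0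
    obtain ⟨c, hc⟩ : ∃ c, (c, b) ∈ M := by
      by_contra h
      exact h0 (hW.freeB b (not_exists.1 h))
    have hcb := hW.matched _ _ hc
    obtain ⟨t, ht, hα⟩ := hkeep c b hc (by omega)
    have hcD : (c, b) ∈ D := (hmemD _ _).2 ⟨t, ht⟩
    have hiff : ∀ d, (d, b) ∈ D ↔ (d, b) ∈ M := fun d =>
      ⟨fun h => hDM.left_unique hcD h ▸ hc, fun h => hM.left_unique hc h ▸ hcD⟩
    refine ⟨?_, if_congr (hiff a) rfl (if_congr (by simp [voteBplus, hiff]) rfl rfl)⟩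
    have h1 := hδS _ _ _ ht
    cases t <;> simp at h1 hα <;> omega
  -- no contract on an unused edge blocks
  have hblock : ∀ a b t, (a, b) ∉ D → (a, b, t) ∈ C →
      (t = true ∧ γ a ≤ 0 ∨ (t = true ∨ γ a ≤ 0) ∧ P.voteAplus D a b) →
      (t = false ∧ δ b ≤ 0 ∨ (t = false ∨ δ b ≤ 0) ∧ P.voteBplus D a b) → False := by
    intro a b t hn hx hA hB
    rcases hstab a b t hx fun h => hn ((hmemD _ _).2 ⟨t, h⟩) with
      ⟨b', t', hy, hlt⟩ | ⟨a', t', hy, hlt⟩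
    · have hs := hγS _ _ _ hy
      have hv : P.voteAplus D a b → P.rankA a b < P.rankA a b' := fun h =>
        h b' ((hmemD _ _).2 ⟨_, hy⟩)
      cases t <;> cases t' <;> simp at hs hlt hA <;> grind
    · have hs := hδS _ _ _ hy
      have hv : P.voteBplus D a b → P.rankB b a < P.rankB b a' := fun h =>
        h a' ((hmemD _ _).2 ⟨_, hy⟩)
      cases t <;> cases t' <;> simp at hs hlt hB <;> grind
  have hWD : P.IsWitness D γ δ := by
    refine ⟨?_, ?_, ?_, ?_, ?_, ?_⟩
    · intro a b h
      obtain ⟨t, ht⟩ := (hmemD _ _).1 h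
      rw [hγS _ _ _ ht, hδS _ _ _ ht]
      cases t <;> simp
    · exact fun a h => hγ0 a fun b t hx => h b ((hmemD _ _).2 ⟨t, hx⟩)
    · exact fun b h => hδ0 b fun a t hx => h a ((hmemD _ _).2 ⟨t, hx⟩)
    · intro a
      have := hγ3 a
      omega
    · intro b
      have := hδ3 b
      omega
    · intro a b hab
      by_cases hn : (a, b) ∈ D
      · obtain ⟨t, ht⟩ := (hmemD _ _).1 hn
        rw [hγS _ _ _ ht, hδS _ _ _ ht]
        cases t <;> simp [voteA, voteB, hn]
      have hγ3' := hγ3 a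
      have hδ3' := hδ3 b
      have hvA := voteA_eq_or (P := P) hn
      have hvB := voteB_eq_or (P := P) hn
      have hedge := hW.edge a b hab
      have hα1 := hW.boundA a
      have hα2 := hW.le_oneA a
      have hβ1 := hW.boundB b
      have hβ2 := hW.le_oneB b
      by_cases hα : α a = 0 <;> by_cases hβ : β b = 0
      · have htrue : δ b ≤ 0 → P.voteB D a b = 1 → γ a ≤ 0 ∨ P.voteA D a b = 1 → False := by
          intro h1 h2 h3
          rw [voteB_eq_one_iff hn] at h2
          rw [voteA_eq_one_iff hn] at h3
          refine hblock a b true hn ((hmem _ _ _).2 ⟨hab, Or.inl ⟨hα, hβ, fun _ a' ha' =>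
            (hplusB a b hβ h1 h2 a' ha').le, by simp⟩⟩) ?_ (Or.inr ⟨Or.inr h1, h2⟩)
          simpa using h3
        have hfalse : γ a ≤ 0 → P.voteA D a b = 1 → δ b ≤ 0 ∨ P.voteB D a b = 1 → False := by
          intro h1 h2 h3
          rw [voteA_eq_one_iff hn] at h2
          rw [voteB_eq_one_iff hn] at h3
          refine hblock a b false hn ((hmem _ _ _).2 ⟨hab, Or.inl ⟨hα, hβ, by simp, fun _ b' hb' =>
            (hplusA a b hα h1 h2 b' hb').le⟩⟩) (Or.inr ⟨Or.inr h1, h2⟩) ?_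
          simpa using h3
        have hfreeB : δ b = 0 → P.voteB D a b = 1 := by
          intro h
          rw [voteB_eq_one_iff hn]
          rcases hsignB b with ⟨-, h1⟩ | ⟨a', t, -, h1⟩
          · intro a' ha'
            obtain ⟨t, ht⟩ := (hmemD _ _).1 ha'
            exact absurd ht (h1 a' t)
          · cases t <;> simp [h] at h1
        have hfreeA : γ a = 0 → P.voteA D a b = 1 := by
          intro h
          rw [voteA_eq_one_iff hn]
          rcases hsignA a with ⟨-, h1⟩ | ⟨b', t, -, h1⟩
          · intro b' hb'
            obtain ⟨t, ht⟩ := (hmemD _ _).1 hb'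
            exact absurd ht (h1 b' t)
          · cases t <;> simp [h] at h1
        clear hedge hα1 hα2 hβ1 hβ2
        grind
      · have hnM : (a, b) ∉ M := fun h => by
          have := hW.matched _ _ h
          omega
        have hsame := hsameB a b hβ
        have hle : γ a ≤ 0 → P.voteA D a b = 1 → P.voteA M a b = 1 := fun h1 h2 =>
          (voteA_eq_one_iff hnM).2 (hplusA a b hα h1 ((voteA_eq_one_iff hn).1 h2))
        have := voteA_eq_or (P := P) hnM
        omega
      · have hnM : (a, b) ∉ M := fun h => by
          have := hW.matched _ _ h
          omega
        have hsame := hsameA a b hα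
        have hle : δ b ≤ 0 → P.voteB D a b = 1 → P.voteB M a b = 1 := fun h1 h2 =>
          (voteB_eq_one_iff hnM).2 (hplusB a b hβ h1 ((voteB_eq_one_iff hn).1 h2))
        have := voteB_eq_or (P := P) hnM
        omega
      · have h1 := hsameA a b hα
        have h2 := hsameB a b hβ
        omega
  refine ⟨D, hWD.dominant hDM fun a b h => ?_, fun a b h h0 => ?_⟩
  · obtain ⟨t, ht⟩ := (hmemD _ _).1 h
    rw [hγS _ _ _ ht]
    cases t <;> simp
  · obtain ⟨t, ht, -⟩ := hkeep a b h h0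
    exact (hmemD _ _).2 ⟨t, ht⟩

end PrefSys

/-- If some popular matching contains the edge `e*`, then some
stable matching or some dominant matching contains `e*`. -/
theorem popular_edge {A B : Type} [Fintype A] [Fintype B]
    (P : PrefSys A B) (e : A × B) (he : P.adj e.1 e.2)
    (h : ∃ M, P.Popular M ∧ e ∈ M) :
    (∃ S, P.Stable S ∧ e ∈ S) ∨ (∃ D, P.Dominant D ∧ e ∈ D) := by
  obtain ⟨M, hP, heM⟩ := h
  obtain ⟨α, β, hW⟩ := hP.exists_isWitness
  by_cases h0 : α e.1 = 0
  · obtain ⟨S, hS, hmem⟩ := hW.exists_stable hP.1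
    exact Or.inl ⟨S, hS, hmem _ _ heM h0⟩
  · obtain ⟨D, hD, hmem⟩ := hW.exists_dominant hP.1
    exact Or.inr ⟨D, hD, hmem _ _ heM h0⟩
end
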